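/- arXiv:2304.04690 — 3 statements merged into one kernel-verified Lean document; each statement's English description precedes it below -/
import Mathlib

section
/- Let k ≥ 1 and let D be a k-extremal digraph. Then D is Eulerian, D is (k+1)-dicritical, and λ(x, y) = k for every ordered pair of distinct vertices x, y of D. In particular, if (X, X̄) is a minimum dicut of D, then so is (X̄, X). -/
/-!
Common framework: finite digraphs on vertex set a `Finset ℕ`,
loopless and without parallel arcs (arcs are a `Finset (ℕ × ℕ)`).
-/

structure Dgraph where
  verts : Finset ℕ
  arcs : Finset (ℕ × ℕ)

namespace Dgraph

/-- Well-formedness: every arc joins two distinct vertices of the digraph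
(no loops, arcs within the vertex set). -/
def WF (D : Dgraph) : Prop :=
  ∀ a ∈ D.arcs, a.1 ∈ D.verts ∧ a.2 ∈ D.verts ∧ a.1 ≠ a.2

/-- `p` is a directed path from `u` to `v` in `D` (vertices pairwise distinct,
consecutive pairs are arcs). -/
def IsDipath (D : Dgraph) (p : List ℕ) (u v : ℕ) : Prop :=
  p.Nodup ∧ p.head? = some u ∧ p.getLast? = some v ∧
    (∀ x ∈ p, x ∈ D.verts) ∧ p.Chain' (fun a b => (a, b) ∈ D.arcs)

/-- The set of arcs used by a path (consecutive pairs). -/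
def arcsOf (p : List ℕ) : Finset (ℕ × ℕ) := (p.zip p.tail).toFinset

/-- Local arc-connectivity `λ(u,v)`: the maximum number of pairwise
arc-disjoint directed paths from `u` to `v`. -/
noncomputable def locLam (D : Dgraph) (u v : ℕ) : ℕ :=
  sSup {n | ∃ P : Fin n → List ℕ, (∀ i, D.IsDipath (P i) u v) ∧
    Pairwise fun i j => Disjoint (arcsOf (P i)) (arcsOf (P j))}

/-- Maximum local arc-connectivity `λ(D)`. -/
noncomputable def lam (D : Dgraph) : ℕ :=
  sSup {n | ∃ u ∈ D.verts, ∃ v ∈ D.verts, u ≠ v ∧ n = D.locLam u v}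

/-- `p` is a directed cycle of `D` (cyclically consecutive pairs are arcs,
vertices pairwise distinct). -/
def IsDicycle (D : Dgraph) (p : List ℕ) : Prop :=
  2 ≤ p.length ∧ p.Nodup ∧ (∀ x ∈ p, x ∈ D.verts) ∧
    p.Chain' (fun a b => (a, b) ∈ D.arcs) ∧
    ∀ x y, p.getLast? = some x → p.head? = some y → (x, y) ∈ D.arcs

/-- A colouring `φ` of the vertices with `k` colours is a `k`-dicolouring if
no directed cycle is monochromatic, i.e. every colour class induces an
acyclic subdigraph. -/
def IsDicolouring (D : Dgraph) (k : ℕ) (φ : ℕ → Fin k) : Prop :=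
  ∀ p, D.IsDicycle p → ¬∃ c, ∀ x ∈ p, φ x = c

/-- The dichromatic number: least `k` admitting a `k`-dicolouring. -/
noncomputable def dichi (D : Dgraph) : ℕ :=
  sInf {k | ∃ φ : ℕ → Fin k, D.IsDicolouring k φ}

/-- A monochromatic list of vertices. -/
def Mono {k : ℕ} (φ : ℕ → Fin k) (p : List ℕ) : Prop := ∃ c, ∀ x ∈ p, φ x = c

/-- `D` is strong: any vertex can reach any other by a directed path. -/
def Strong (D : Dgraph) : Prop :=
  ∀ u ∈ D.verts, ∀ v ∈ D.verts, u ≠ v → ∃ p, D.IsDipath p u v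

/-- Induced subdigraph on `S`. -/
def induce (D : Dgraph) (S : Finset ℕ) : Dgraph where
  verts := D.verts ∩ S
  arcs := D.arcs.filter fun a => a.1 ∈ S ∧ a.2 ∈ S

/-- Adjacency in the underlying undirected graph. -/
def adj (D : Dgraph) (x y : ℕ) : Prop := (x, y) ∈ D.arcs ∨ (y, x) ∈ D.arcs

/-- Reachability in the underlying undirected graph. -/
def UReach (D : Dgraph) (x y : ℕ) : Prop := Relation.ReflTransGen D.adj x y

/-- Connectivity of the underlying undirected graph. -/
def UConnected (D : Dgraph) : Prop :=
  D.verts.Nonempty ∧ ∀ u ∈ D.verts, ∀ v ∈ D.verts, D.UReach u v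

/-- Deletion of a vertex. -/
def delVert (D : Dgraph) (v : ℕ) : Dgraph := D.induce (D.verts.erase v)

/-- `v` is a cutvertex: its removal disconnects the underlying graph. -/
def IsCutvertex (D : Dgraph) (v : ℕ) : Prop :=
  v ∈ D.verts ∧ ¬(D.delVert v).UConnected

/-- Biconnected: the underlying graph is connected and has no cutvertex. -/
def Biconnected (D : Dgraph) : Prop :=
  D.UConnected ∧ ∀ v, ¬D.IsCutvertex v

/-- `D` is `k`-extremal: biconnected, strong and `χ⃗(D) = λ(D) + 1 = k + 1`. -/
def Extremal (k : ℕ) (D : Dgraph) : Prop :=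
  D.Biconnected ∧ D.Strong ∧ D.dichi = k + 1 ∧ D.lam = k

/-- The arcs of the dicut `(X, X̄)`: arcs from `X` to its complement. -/
def dicutArcs (D : Dgraph) (X : Finset ℕ) : Finset (ℕ × ℕ) :=
  D.arcs.filter fun a => a.1 ∈ X ∧ a.2 ∉ X

/-- `X` is the side of a dicut: `∅ ≠ X ⊊ V(D)`. -/
def IsDicutSide (D : Dgraph) (X : Finset ℕ) : Prop :=
  X ⊆ D.verts ∧ X.Nonempty ∧ X ≠ D.verts

/-- `(X, X̄)` is a minimum dicut of `D`. -/
def IsMinDicut (D : Dgraph) (X : Finset ℕ) : Prop :=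
  D.IsDicutSide X ∧ ∀ Y, D.IsDicutSide Y → (D.dicutArcs X).card ≤ (D.dicutArcs Y).card

def outdeg (D : Dgraph) (v : ℕ) : ℕ := (D.arcs.filter fun a => a.1 = v).card
def indeg (D : Dgraph) (v : ℕ) : ℕ := (D.arcs.filter fun a => a.2 = v).card

/-- Eulerian: every vertex has equal in- and out-degree. -/
def Eulerian (D : Dgraph) : Prop := ∀ v ∈ D.verts, D.outdeg v = D.indeg v

/-- Deleting a set of arcs. -/
def delArcs (D : Dgraph) (s : Finset (ℕ × ℕ)) : Dgraph := ⟨D.verts, D.arcs \ s⟩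

/-- Adding an arc. -/
def addArc (D : Dgraph) (u v : ℕ) : Dgraph :=
  ⟨insert u (insert v D.verts), insert (u, v) D.arcs⟩

/-- `D` is `m`-dicritical: `χ⃗(D) = m` and deleting any arc drops the
dichromatic number to at most `m - 1`. -/
def Dicritical (m : ℕ) (D : Dgraph) : Prop :=
  D.dichi = m ∧ ∀ a ∈ D.arcs, (D.delArcs {a}).dichi ≤ m - 1

/-- Renaming a vertex `x` to `y`. -/
def ren (x y z : ℕ) : ℕ := if z = x then y else z

def renArc (x y : ℕ) (a : ℕ × ℕ) : ℕ × ℕ := (ren x y a.1, ren x y a.2)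

/-- Cyclically consecutive pairs of a list: the arcs of the directed cycle
through `p` in this cyclic order. -/
def cycArcs (p : List ℕ) : Finset (ℕ × ℕ) := (p.zip (p.rotate 1)).toFinset

/-- `D` is a directed cycle. -/
def IsDirectedCycleGraph (D : Dgraph) : Prop :=
  ∃ p : List ℕ, 2 ≤ p.length ∧ p.Nodup ∧ D.verts = p.toFinset ∧ D.arcs = cycArcs p

/-- `D` is the bidirected complete digraph `↔K_n`. -/
def IsBiComplete (D : Dgraph) (n : ℕ) : Prop :=
  D.verts.card = n ∧ D.arcs = (D.verts ×ˢ D.verts).filter fun a => a.1 ≠ a.2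

/-- Arcs of a bidirected (symmetric) cycle through `p`. -/
def symmCyc (p : List ℕ) : Finset (ℕ × ℕ) := cycArcs p ∪ (cycArcs p).image Prod.swap

/-- `D` is a symmetric odd wheel: a bidirected odd cycle (≥ 3 vertices)
plus a hub joined by digons to all cycle vertices. -/
def IsSymOddWheel (D : Dgraph) : Prop :=
  ∃ (p : List ℕ) (x : ℕ), 3 ≤ p.length ∧ Odd p.length ∧ p.Nodup ∧ x ∉ p ∧
    D.verts = insert x p.toFinset ∧
    D.arcs = symmCyc p ∪ p.toFinset.image (fun y => (x, y)) ∪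
      p.toFinset.image (fun y => (y, x))

/-- A fresh vertex not in `D`. -/
def fresh (D : Dgraph) : ℕ := (D.verts.sup id) + 1

/-- Contraction `D/X`: `X` is contracted into a single new vertex; arcs
inside `X` are deleted and parallel arcs created by contraction are
identified. -/
def contract (D : Dgraph) (X : Finset ℕ) : Dgraph where
  verts := insert (fresh D) (D.verts \ X)
  arcs := (D.arcs.image fun a =>
      (if a.1 ∈ X then fresh D else a.1, if a.2 ∈ X then fresh D else a.2)).filter
      fun a => a.1 ≠ a.2

/-- `D` is the directed Hajós join of `D1` and `D2` with respect to the arcs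
`(u,v1) ∈ A(D1)` and `(v2,w) ∈ A(D2)`, the vertices `v1, v2` being
identified into the new vertex `v`, and the arc `(u,w)` being added. -/
def IsDirHajosJoinAt (D D1 D2 : Dgraph) (u v1 v2 w v : ℕ) : Prop :=
  D1.WF ∧ D2.WF ∧ Disjoint D1.verts D2.verts ∧
  (u, v1) ∈ D1.arcs ∧ (v2, w) ∈ D2.arcs ∧
  v ∉ (D1.verts.erase v1) ∪ (D2.verts.erase v2) ∧
  D.verts = insert v ((D1.verts.erase v1) ∪ (D2.verts.erase v2)) ∧
  D.arcs = insert (u, w)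
    (((D1.arcs.erase (u, v1)) ∪ (D2.arcs.erase (v2, w))).image
      fun a => renArc v2 v (renArc v1 v a))

def IsDirHajosJoin (D D1 D2 : Dgraph) : Prop :=
  ∃ u v1 v2 w v, IsDirHajosJoinAt D D1 D2 u v1 v2 w v

/-- Bidirected Hajós join with respect to the digons `[u,v1] ⊆ A(D1)` and
`[w,v2] ⊆ A(D2)`. -/
def IsBidirHajosJoinAt (D D1 D2 : Dgraph) (u v1 v2 w v : ℕ) : Prop :=
  D1.WF ∧ D2.WF ∧ Disjoint D1.verts D2.verts ∧
  (u, v1) ∈ D1.arcs ∧ (v1, u) ∈ D1.arcs ∧ (w, v2) ∈ D2.arcs ∧ (v2, w) ∈ D2.arcs ∧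
  v ∉ (D1.verts.erase v1) ∪ (D2.verts.erase v2) ∧
  D.verts = insert v ((D1.verts.erase v1) ∪ (D2.verts.erase v2)) ∧
  D.arcs = insert (u, w) (insert (w, u)
    (((D1.arcs \ {(u, v1), (v1, u)}) ∪ (D2.arcs \ {(w, v2), (v2, w)})).image
      fun a => renArc v2 v (renArc v1 v a)))

def IsBidirHajosJoin (D D1 D2 : Dgraph) : Prop :=
  ∃ u v1 v2 w v, IsBidirHajosJoinAt D D1 D2 u v1 v2 w v

/-- Hajós bijoin of `D1` and `D2` with respect to `((t,a1,w),(v,a2,u))`: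
`ta1, a1w ∈ A(D1)` with `t,w` in the same connected component of `D1 ∖ a1`,
`va2, a2u ∈ A(D2)` with `u,v` in the same connected component of `D2 ∖ a2`;
`a1` and `a2` are identified into the new vertex `a` and the arcs
`tu` and `vw` are added. -/
def IsHajosBijoinAt (D D1 D2 : Dgraph) (t a1 w v a2 u a : ℕ) : Prop :=
  D1.WF ∧ D2.WF ∧ Disjoint D1.verts D2.verts ∧
  (t, a1) ∈ D1.arcs ∧ (a1, w) ∈ D1.arcs ∧
  (v, a2) ∈ D2.arcs ∧ (a2, u) ∈ D2.arcs ∧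
  (D1.delVert a1).UReach t w ∧
  (D2.delVert a2).UReach u v ∧
  a ∉ (D1.verts.erase a1) ∪ (D2.verts.erase a2) ∧
  D.verts = insert a ((D1.verts.erase a1) ∪ (D2.verts.erase a2)) ∧
  D.arcs = insert (t, u) (insert (v, w)
    (((D1.arcs \ {(t, a1), (a1, w)}) ∪ (D2.arcs \ {(v, a2), (a2, u)})).image
      fun x => renArc a2 a (renArc a1 a x)))

def IsHajosBijoin (D D1 D2 : Dgraph) : Prop :=
  ∃ t a1 w v a2 u a, IsHajosBijoinAt D D1 D2 t a1 w v a2 u a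

/-! ### Trees, Euler tours and Hajós tree joins -/

/-- Vertex set of the tree given by edges `e : Fin n → ℕ × ℕ`. -/
def treeVerts (n : ℕ) (e : Fin n → ℕ × ℕ) : Finset ℕ :=
  Finset.univ.image (fun i => (e i).1) ∪ Finset.univ.image (fun i => (e i).2)

/-- The bidirected digraph `↔T` of the tree. -/
def treeDigraph (n : ℕ) (e : Fin n → ℕ × ℕ) : Dgraph where
  verts := treeVerts n e
  arcs := Finset.univ.image (fun i : Fin n => e i) ∪
    Finset.univ.image (fun i : Fin n => (e i).swap)

/-- `e` lists the edges of a tree: loopless, pairwise distinct edges,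
connected, with `n + 1` vertices for `n` edges. -/
def IsTree (n : ℕ) (e : Fin n → ℕ × ℕ) : Prop :=
  (∀ i, (e i).1 ≠ (e i).2) ∧
  (∀ i j, i ≠ j → e i ≠ e j ∧ e i ≠ (e j).swap) ∧
  (treeDigraph n e).UConnected ∧
  (treeVerts n e).card = n + 1

/-- The leaves of the tree: vertices incident to exactly one edge. -/
def leafSet (n : ℕ) (e : Fin n → ℕ × ℕ) : Finset ℕ :=
  (treeVerts n e).filter fun x =>
    (Finset.univ.filter fun i : Fin n => (e i).1 = x ∨ (e i).2 = x).card = 1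

/-- `L` is an Eulerian list of the tree: the cyclic sequence of consecutive
pairs of `L` traverses each arc of `↔T` exactly once. -/
def IsEulerTour (n : ℕ) (e : Fin n → ℕ × ℕ) (L : List ℕ) : Prop :=
  ((L.zip (L.rotate 1) : List (ℕ × ℕ)) : Multiset (ℕ × ℕ)) = (treeDigraph n e).arcs.val

/-- `C` is a partial Eulerian list: a circular sublist of an Eulerian list
containing every leaf, in which every non-leaf vertex appears at most once. -/
def IsPartialEulerList (n : ℕ) (e : Fin n → ℕ × ℕ) (C : List ℕ) : Prop :=
  ∃ L m, IsEulerTour n e L ∧ List.Sublist C (L.rotate m) ∧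
    (∀ x ∈ leafSet n e, x ∈ C) ∧
    ∀ x ∈ C, x ∉ leafSet n e → C.count x ≤ 1

/-- Compatibility of the data of a (extended) Hajós tree join:
a tree with edges `uᵢvᵢ = e i`, digraphs `Ds i` with
`V(Ds i) ∩ V(T) = {uᵢ, vᵢ}`, `[uᵢ,vᵢ] ⊆ A(Ds i)` and whose remaining
vertex sets are pairwise disjoint. -/
def JoinCompat (n : ℕ) (e : Fin n → ℕ × ℕ) (Ds : Fin n → Dgraph) : Prop :=
  IsTree n e ∧ (∀ i, (Ds i).WF) ∧
  (∀ i, (Ds i).verts ∩ treeVerts n e = {(e i).1, (e i).2}) ∧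
  (∀ i, e i ∈ (Ds i).arcs ∧ (e i).swap ∈ (Ds i).arcs) ∧
  (∀ i j, i ≠ j →
    Disjoint ((Ds i).verts \ {(e i).1, (e i).2}) ((Ds j).verts \ {(e j).1, (e j).2}))

/-- The digraph obtained from the digraphs `Ds i − [uᵢ,vᵢ]` by adding the
directed cycle through the list `C`. -/
def joinOf (n : ℕ) (e : Fin n → ℕ × ℕ) (Ds : Fin n → Dgraph) (C : List ℕ) : Dgraph where
  verts := Finset.univ.biUnion fun i => (Ds i).verts
  arcs := (Finset.univ.biUnion fun i => (Ds i).arcs \ {e i, (e i).swap}) ∪ cycArcs C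

/-- `D` is the Hajós tree join `T(D₁, …, Dₙ; C)`: the peripheral cycle runs
through the leaves of `T` in the circular order given by a plane embedding
of `T` (equivalently, the order of the leaves along an Euler tour of `↔T`). -/
def IsHajosTreeJoin (D : Dgraph) (n : ℕ) (e : Fin n → ℕ × ℕ)
    (Ds : Fin n → Dgraph) : Prop :=
  JoinCompat n e Ds ∧ ∃ L, IsEulerTour n e L ∧
    D = joinOf n e Ds (L.filter fun x => decide (x ∈ leafSet n e))

/-- `D` is an extended Hajós tree join: the peripheral cycle runs through a
partial Eulerian list of `T`. -/
def IsExtHajosTreeJoin (D : Dgraph) (n : ℕ) (e : Fin n → ℕ × ℕ)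
    (Ds : Fin n → Dgraph) : Prop :=
  JoinCompat n e Ds ∧ ∃ C, IsPartialEulerList n e C ∧ D = joinOf n e Ds C

/-- Hajós star join: a Hajós tree join whose tree is a star. -/
def IsHajosStarJoin (D : Dgraph) (n : ℕ) (e : Fin n → ℕ × ℕ)
    (Ds : Fin n → Dgraph) : Prop :=
  IsHajosTreeJoin D n e Ds ∧ ∃ c, ∀ i, (e i).1 = c ∨ (e i).2 = c

/-- The class `H⃗_k`: for `k = 3` the smallest class containing the symmetric
odd wheels and closed under directed Hajós joins and Hajós tree joins; for
`k ≥ 4` the smallest class containing `↔K_{k+1}` and closed under directed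
Hajós joins and Hajós tree joins. -/
inductive HClass (k : ℕ) : Dgraph → Prop
  | wheel (D : Dgraph) (hk : k = 3) (h : IsSymOddWheel D) : HClass k D
  | complete (D : Dgraph) (hk : 4 ≤ k) (h : IsBiComplete D (k + 1)) : HClass k D
  | dirJoin (D D1 D2 : Dgraph) (h1 : HClass k D1) (h2 : HClass k D2)
      (h : IsDirHajosJoin D D1 D2) : HClass k D
  | treeJoin (D : Dgraph) (n : ℕ) (e : Fin n → ℕ × ℕ) (Ds : Fin n → Dgraph)
      (h : ∀ i, HClass k (Ds i)) (hj : IsHajosTreeJoin D n e Ds) : HClass k D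

/-- The class `EH⃗T_k`: for `k = 3` the smallest class containing the
symmetric odd wheels and closed under extended Hajós tree joins; for `k ≥ 4`
the smallest class containing `↔K_{k+1}` and closed under extended Hajós
tree joins. -/
inductive EHTClass (k : ℕ) : Dgraph → Prop
  | wheel (D : Dgraph) (hk : k = 3) (h : IsSymOddWheel D) : EHTClass k D
  | complete (D : Dgraph) (hk : 4 ≤ k) (h : IsBiComplete D (k + 1)) : EHTClass k D
  | extJoin (D : Dgraph) (n : ℕ) (e : Fin n → ℕ × ℕ) (Ds : Fin n → Dgraph)
      (h : ∀ i, EHTClass k (Ds i)) (hj : IsExtHajosTreeJoin D n e Ds) : EHTClass k D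

/-- Parallel Hajós join of `D_AC` and `D_B` with respect to
`(t, u, v, w, [a,b])`. -/
def IsParallelHajosJoinAt (D DAC DB : Dgraph) (A C : Finset ℕ)
    (x t u v w a b : ℕ) : Prop :=
  DAC.WF ∧ DB.WF ∧
  (a, b) ∈ DB.arcs ∧ (b, a) ∈ DB.arcs ∧
  DAC.verts = A ∪ C ∧ A ∩ C = {x} ∧
  t ∈ A.erase x ∧ w ∈ A.erase x ∧ u ∈ C.erase x ∧ v ∈ C.erase x ∧
  (t, u) ∈ DAC.arcs ∧ (v, w) ∈ DAC.arcs ∧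
  (DAC.delVert x).UReach t w ∧
  ((DAC.induce C).delVert x).UReach u v ∧
  Disjoint DAC.verts DB.verts ∧
  D.verts = DB.verts ∪ (A.erase x) ∪ (C.erase x) ∧
  D.arcs = insert (t, u) (insert (v, w)
    ((DB.arcs \ {(a, b), (b, a)}) ∪
      ((DAC.induce A).arcs.image (renArc x a)) ∪
      ((DAC.induce C).arcs.image (renArc x b))))

def IsParallelHajosJoin (D DAC DB : Dgraph) : Prop :=
  ∃ A C x t u v w a b, IsParallelHajosJoinAt D DAC DB A C x t u v w a b

/-- `S` is (the vertex set of) a strong component of `D`. -/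
def IsStrongComponent (D : Dgraph) (S : Finset ℕ) : Prop :=
  S ⊆ D.verts ∧ S.Nonempty ∧ (D.induce S).Strong ∧
  ∀ S', S ⊆ S' → S' ⊆ D.verts → (D.induce S').Strong → S' = S

/-- `B` is (the vertex set of) a block of `D`: a maximal set inducing a
biconnected subdigraph. -/
def IsBlock (D : Dgraph) (B : Finset ℕ) : Prop :=
  B ⊆ D.verts ∧ (D.induce B).Biconnected ∧
  ∀ B', B ⊆ B' → B' ⊆ D.verts → (D.induce B').Biconnected → B' = B

end Dgraph

open Dgraph

open Dgraph

namespace Ext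
open Classical in
noncomputable def ct (A : Finset (ℕ × ℕ)) (X : Finset ℕ) : ℤ :=
  ∑ a ∈ A, if a.1 ∈ X ∧ a.2 ∉ X then 1 else 0

def bl (A : Finset (ℕ × ℕ)) (v : ℕ) : ℤ :=
  ∑ a ∈ A, ((if a.1 = v then 1 else 0) - (if a.2 = v then 1 else 0))

lemma ct_card (A : Finset (ℕ × ℕ)) (X : Finset ℕ) :
    ct A X = ((A.filter fun a => a.1 ∈ X ∧ a.2 ∉ X).card : ℤ) := by
  rw [Finset.card_filter]
  unfold ct
  push_cast
  apply Finset.sum_congr rfl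
  intros
  congr

lemma ct_nonneg (A : Finset (ℕ × ℕ)) (X : Finset ℕ) : 0 ≤ ct A X := by
  rw [ct_card]; positivity

lemma ct_submod (A : Finset (ℕ × ℕ)) (X Y : Finset ℕ) :
    ct A (X ∪ Y) + ct A (X ∩ Y) ≤ ct A X + ct A Y := by
  unfold ct
  rw [← Finset.sum_add_distrib, ← Finset.sum_add_distrib]
  apply Finset.sum_le_sum
  intro a _
  by_cases h1 : a.1 ∈ X <;> by_cases h2 : a.2 ∈ X <;> by_cases h3 : a.1 ∈ Y <;>
    by_cases h4 : a.2 ∈ Y <;> simp [h1, h2, h3, h4]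

lemma sum_bl (A : Finset (ℕ × ℕ)) (R : Finset ℕ) :
    ∑ v ∈ R, bl A v = ∑ a ∈ A, ((if a.1 ∈ R then 1 else 0) - (if a.2 ∈ R then (1 : ℤ) else 0)) := by
  unfold bl
  rw [Finset.sum_comm]
  apply Finset.sum_congr rfl
  intro a _
  rw [Finset.sum_sub_distrib]
  simp

lemma bl_union (A B : Finset (ℕ × ℕ)) (h : Disjoint A B) (v : ℕ) :
    bl (A ∪ B) v = bl A v + bl B v := by
  unfold bl
  rw [Finset.sum_union h]

lemma bl_sdiff (A B : Finset (ℕ × ℕ)) (h : B ⊆ A) (v : ℕ) :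
    bl (A \ B) v = bl A v - bl B v := by
  have := bl_union (A \ B) B Finset.sdiff_disjoint v
  rw [Finset.sdiff_union_of_subset h] at this
  omega

/-- path in an arc set -/
def IsP (A : Finset (ℕ × ℕ)) (p : List ℕ) (u v : ℕ) : Prop :=
  p.Nodup ∧ p.head? = some u ∧ p.getLast? = some v ∧ p.IsChain (fun a b => (a, b) ∈ A)

lemma isP_of_reach {A : Finset (ℕ × ℕ)} {x y : ℕ}
    (h : Relation.ReflTransGen (fun a b => (a, b) ∈ A) x y) : ∃ p, IsP A p x y := by
  induction h using Relation.ReflTransGen.head_induction_on with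
  | refl => exact ⟨[y], by simp [IsP]⟩
  | head hac _ ih =>
    rename_i a c _
    obtain ⟨p, h1, h2, h3, h4⟩ := ih
    by_cases hp : a ∈ p
    · obtain ⟨s, t, rfl⟩ := List.append_of_mem hp
      refine ⟨a :: t, ?_, by simp, ?_, ?_⟩
      · exact (List.nodup_append.1 h1).2.1
      · rw [List.getLast?_append] at h3
        simpa using h3
      · exact (List.isChain_append.1 h4).2.1
    · cases p with
      | nil => simp at h2
      | cons b t =>
        simp at h2
        subst h2
        refine ⟨a :: b :: t, ?_, by simp, ?_, ?_⟩
        · exact List.nodup_cons.2 ⟨hp, h1⟩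
        · rw [List.getLast?_cons_cons]; exact h3
        · exact List.isChain_cons_cons.2 ⟨hac, h4⟩

lemma arcsOf_cons (a b : ℕ) (t : List ℕ) :
    Dgraph.arcsOf (a :: b :: t) = insert (a, b) (Dgraph.arcsOf (b :: t)) := by
  simp [Dgraph.arcsOf]

lemma arcsOf_mem {p : List ℕ} {e : ℕ × ℕ} (h : e ∈ Dgraph.arcsOf p) : e.1 ∈ p ∧ e.2 ∈ p := by
  unfold Dgraph.arcsOf at h
  rw [List.mem_toFinset] at h
  have := List.of_mem_zip (a := e.1) (b := e.2) h
  exact ⟨this.1, List.mem_of_mem_tail this.2⟩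

lemma arcsOf_sub {A : Finset (ℕ × ℕ)} : ∀ {p : List ℕ}, p.IsChain (fun a b => (a, b) ∈ A) →
    Dgraph.arcsOf p ⊆ A
  | [], _ => by simp [Dgraph.arcsOf]
  | [a], _ => by simp [Dgraph.arcsOf]
  | a :: b :: t, h => by
    rw [List.isChain_cons_cons] at h
    rw [arcsOf_cons]
    exact Finset.insert_subset h.1 (arcsOf_sub h.2)

lemma bl_arcsOf : ∀ (p : List ℕ) (x y : ℕ), p.Nodup → p.head? = some x → p.getLast? = some y →
    ∀ v, bl (Dgraph.arcsOf p) v = (if x = v then 1 else 0) - (if y = v then 1 else 0)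
  | [], x, y, _, h, _, v => by simp at h
  | [a], x, y, _, h, h', v => by
    simp at h h'; subst h; subst h'
    simp [Dgraph.arcsOf, bl]
  | a :: b :: t, x, y, hn, h, h', v => by
    simp at h; subst h
    rw [List.getLast?_cons_cons] at h'
    rw [List.nodup_cons] at hn
    have ih := bl_arcsOf (b :: t) b y hn.2 (by simp) h' v
    rw [arcsOf_cons]
    have hni : (a, b) ∉ Dgraph.arcsOf (b :: t) := fun hh => hn.1 (arcsOf_mem hh).1
    unfold bl at ih ⊢
    rw [Finset.sum_insert hni, ih]
    ring

lemma paths_of_flow (x y : ℕ) (hxy : x ≠ y) : ∀ (n : ℕ) (A : Finset (ℕ × ℕ)),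
    (∀ v, v ≠ x → v ≠ y → 0 ≤ bl A v) → (n : ℤ) ≤ bl A x →
    ∃ P : Fin n → List ℕ, (∀ i, IsP A (P i) x y) ∧
      Pairwise fun i j => Disjoint (Dgraph.arcsOf (P i)) (Dgraph.arcsOf (P j)) := by
  intro n
  induction n with
  | zero => intro A _ _; exact ⟨fun i => i.elim0, fun i => i.elim0, fun i => i.elim0⟩
  | succ n ih =>
    intro A hA hx
    have hreach : Relation.ReflTransGen (fun a b => (a, b) ∈ A) x y := by
      classical
      by_contra hcon
      let R : Finset ℕ := (insert x (A.image Prod.snd)).filter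
        fun v => Relation.ReflTransGen (fun a b => (a, b) ∈ A) x v
      have hxR : x ∈ R := by simp [R, Relation.ReflTransGen.refl]
      have h1 : ∑ v ∈ R, bl A v ≤ 0 := by
        rw [sum_bl]
        apply Finset.sum_nonpos
        rintro ⟨u, w⟩ ha
        by_cases hu : u ∈ R
        · have hw : w ∈ R := by
            simp only [R, Finset.mem_filter] at hu ⊢
            refine ⟨Finset.mem_insert_of_mem (Finset.mem_image_of_mem Prod.snd ha), hu.2.tail ha⟩
          simp [hu, hw]
        · simp only [hu, if_false]
          split_ifs <;> simp
      have h2 : bl A x ≤ ∑ v ∈ R, bl A v := by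
        apply Finset.single_le_sum (f := fun v => bl A v) _ hxR
        intro v hv
        by_cases hvx : v = x
        · subst hvx; push_cast at hx; show 0 ≤ bl A v; omega
        · apply hA v hvx
          rintro rfl
          simp only [R, Finset.mem_filter] at hv
          exact hcon hv.2
      push_cast at hx
      omega
    obtain ⟨p, hp⟩ := isP_of_reach hreach
    have hsub := arcsOf_sub hp.2.2.2
    have hb := bl_arcsOf p x y hp.1 hp.2.1 hp.2.2.1
    obtain ⟨P, hP1, hP2⟩ := ih (A \ Dgraph.arcsOf p) (by
      intro v h1 h2
      rw [bl_sdiff _ _ hsub, hb]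
      simp [Ne.symm h1, Ne.symm h2, hA v h1 h2]) (by
      rw [bl_sdiff _ _ hsub, hb]
      simp [Ne.symm hxy]
      push_cast at hx
      omega)
    have hd : ∀ i, Disjoint (Dgraph.arcsOf p) (Dgraph.arcsOf (P i)) := fun i =>
      Finset.disjoint_sdiff.mono_right (arcsOf_sub (hP1 i).2.2.2)
    refine ⟨Fin.cons p P, ?_, ?_⟩
    · intro i
      refine Fin.cases ?_ ?_ i
      · exact hp
      · intro j
        have := hP1 j
        refine ⟨this.1, this.2.1, this.2.2.1, ?_⟩
        simp only [Fin.cons_succ]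
        exact this.2.2.2.imp (fun a b h => (Finset.mem_sdiff.1 h).1)
    · intro i j
      refine Fin.cases ?_ (fun i' => ?_) i <;> refine Fin.cases ?_ (fun j' => ?_) j
      · intro h; exact absurd rfl h
      · intro _; simpa using hd j'
      · intro _; simpa using (hd i').symm
      · intro h
        simpa using hP2 (fun h' => h (by rw [h']))

lemma menger_aux (x y : ℕ) (hxy : x ≠ y) (n : ℕ) (A : Finset (ℕ × ℕ))
    (hA : ∀ X, x ∈ X → y ∉ X → (n : ℤ) ≤ ct A X) :
    ∃ P : Fin n → List ℕ, (∀ i, IsP A (P i) x y) ∧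
      Pairwise fun i j => Disjoint (Dgraph.arcsOf (P i)) (Dgraph.arcsOf (P j)) := by
  classical
  obtain ⟨B, hB, hBmin⟩ := Finset.exists_min_image
    (A.powerset.filter fun B => ∀ X, x ∈ X → y ∉ X → (n : ℤ) ≤ ct B X) Finset.card
    ⟨A, by simp; exact hA⟩
  simp only [Finset.mem_filter, Finset.mem_powerset] at hB hBmin
  obtain ⟨hBA, hB⟩ := hB
  have tight : ∀ e ∈ B, ∃ X, x ∈ X ∧ y ∉ X ∧ ct B X = n ∧ e.1 ∈ X ∧ e.2 ∉ X := by
    intro e he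
    by_contra hcon
    have := hBmin (B.erase e) ⟨(Finset.erase_subset _ _).trans hBA, by
      intro X hx hy
      by_contra hlt
      have h1 := hB X hx hy
      have h2 : ct B X = _ + ct (B.erase e) X := (Finset.add_sum_erase B _ he).symm

      split_ifs at h2 with h3
      · exact hcon ⟨X, hx, hy, by omega, h3⟩
      · omega⟩
    have := Finset.card_erase_lt_of_mem he
    omega
  have hx0 : (n : ℤ) ≤ bl B x := by
    refine (hB {x} (by simp) (by simpa using hxy.symm)).trans ?_
    apply Finset.sum_le_sum
    intro e he
    have : e.2 ≠ x := by
      rintro rfl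
      obtain ⟨X, h1, _, _, _, h2⟩ := tight e he
      exact h2 h1
    by_cases h : e.1 = x <;> simp [h, this]
  have hv : ∀ v, v ≠ x → v ≠ y → 0 ≤ bl B v := by
    intro v hvx hvy
    by_cases hin : ∃ e ∈ B, e.2 = v
    · obtain ⟨e, he, hev⟩ := hin
      obtain ⟨X0, h1, h2, h3, h4, h5⟩ := tight e he
      let m : Finset ℕ → ℕ := fun X => (B.filter fun a => a.2 = v ∧ a.1 ∈ X).card
      let S : Set (Finset ℕ) := {X | x ∈ X ∧ y ∉ X ∧ ct B X = n ∧ v ∉ X}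
      have hS : ∃ X ∈ S, ∀ Y ∈ S, m Y ≤ m X := by
        have hne : (m '' S).Nonempty := ⟨_, X0, ⟨h1, h2, h3, hev ▸ h5⟩, rfl⟩
        have hbd : BddAbove (m '' S) := ⟨B.card, by
          rintro _ ⟨X, _, rfl⟩; exact Finset.card_filter_le _ _⟩
        obtain ⟨X, hX, hmX⟩ := Nat.sSup_mem hne hbd
        exact ⟨X, hX, fun Y hY => hmX ▸ le_csSup hbd ⟨Y, hY, rfl⟩⟩
      obtain ⟨X, ⟨hX1, hX2, hX3, hX4⟩, hmax⟩ := hS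
      have hall : ∀ a ∈ B, a.2 = v → a.1 ∈ X := by
        intro a ha hav
        by_contra hna
        obtain ⟨Y, g1, g2, g3, g4, g5⟩ := tight a ha
        have hsm := ct_submod B X Y
        have u1 := hB (X ∪ Y) (by simp [hX1]) (by simp [hX2, g2])
        have u2 := hB (X ∩ Y) (by simp [hX1, g1]) (by simp [hX2])
        have hle := hmax (X ∪ Y) ⟨by simp [hX1], by simp [hX2, g2], by omega,
          by simp [hX4]; exact hav ▸ g5⟩
        have : m X < m (X ∪ Y) := by
          apply Finset.card_lt_card
          rw [Finset.ssubset_iff_of_subset]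
          · exact ⟨a, by simp [ha, hav, g4], by simp [hna]⟩
          · intro c; simp; tauto
        omega
      have hle := hB (insert v X) (by simp [hX1]) (by simp [hX2, Ne.symm hvy])
      have : ct B (insert v X) - ct B X ≤ bl B v := by
        unfold ct bl
        rw [← Finset.sum_sub_distrib]
        apply Finset.sum_le_sum
        intro a ha
        have := hall a ha
        by_cases c1 : a.2 = v
        · have c2 := this c1
          have c3 : a.1 ≠ v := fun h => hX4 (h ▸ c2)
          simp [c1, c2, c3, hX4]
        · by_cases c2 : a.1 = v
          · simp [c1, c2, hX4]; split_ifs <;> simp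
          · simp [c1, c2]
      omega
    · push Not at hin
      apply Finset.sum_nonneg
      intro a ha
      simp [hin a ha]
      split_ifs <;> simp
  obtain ⟨P, hP, hP'⟩ := paths_of_flow x y hxy n B hv hx0
  refine ⟨P, fun i => ?_, hP'⟩
  obtain ⟨a, b, c, d⟩ := hP i
  exact ⟨a, b, c, d.imp fun _ _ h => hBA h⟩

lemma chain_verts {D : Dgraph} (hWF : D.WF) : ∀ (p : List ℕ) (u : ℕ), u ∈ D.verts →
    p.head? = some u → p.IsChain (fun a b => (a, b) ∈ D.arcs) → ∀ z ∈ p, z ∈ D.verts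
  | [], _, _, _, _ => by simp
  | [a], u, hu, h, _ => by simp at h ⊢; rw [h]; exact hu
  | a :: b :: t, u, hu, h, hc => by
    simp at h; subst h
    rw [List.isChain_cons_cons] at hc
    have := chain_verts hWF (b :: t) b (hWF _ hc.1).2.1 (by simp) hc.2
    intro z hz
    rcases List.mem_cons.1 hz with rfl | hz
    · exact hu
    · exact this z hz

lemma arcsOf_nonempty {p : List ℕ} {u v : ℕ} (huv : u ≠ v) (h : p.head? = some u)
    (h' : p.getLast? = some v) : (Dgraph.arcsOf p).Nonempty := by
  match p with
  | [] => simp at h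
  | [a] => simp at h h'; omega
  | a :: b :: t => rw [arcsOf_cons]; simp

lemma locLam_bdd (D : Dgraph) (x y : ℕ) (hxy : x ≠ y) :
    BddAbove {n | ∃ P : Fin n → List ℕ, (∀ i, D.IsDipath (P i) x y) ∧
    Pairwise fun i j => Disjoint (Dgraph.arcsOf (P i)) (Dgraph.arcsOf (P j))} := by
  refine ⟨D.arcs.card, ?_⟩
  rintro n ⟨P, hP, hd⟩
  have hne : ∀ i, ∃ e, e ∈ Dgraph.arcsOf (P i) := fun i =>
    arcsOf_nonempty hxy (hP i).2.1 (hP i).2.2.1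
  choose f hf using hne
  have hinj : Function.Injective f := by
    intro i j hij
    by_contra hne
    exact Finset.disjoint_left.1 (hd hne) (hf i) (hij ▸ hf j)
  have := Finset.card_le_card_of_injOn (s := Finset.univ) (t := D.arcs) f
    (fun i _ => arcsOf_sub (hP i).2.2.2.2 (hf i)) hinj.injOn
  simpa using this

lemma menger (D : Dgraph) (hWF : D.WF) (x y : ℕ) (hx : x ∈ D.verts) (hxy : x ≠ y) :
    ∃ X, x ∈ X ∧ y ∉ X ∧ ct D.arcs X ≤ D.locLam x y := by
  by_contra hcon
  push Not at hcon
  obtain ⟨P, hP, hd⟩ := menger_aux x y hxy (D.locLam x y + 1) D.arcs (by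
    intro X h1 h2
    have := hcon X h1 h2
    push_cast; omega)
  have := le_csSup (locLam_bdd D x y hxy) (a := D.locLam x y + 1) ⟨P, fun i => by
    obtain ⟨a, b, c, d⟩ := hP i
    exact ⟨a, b, c, chain_verts hWF _ x hx b d, d⟩, hd⟩
  unfold Dgraph.locLam at this
  omega

lemma locLam_le (D : Dgraph) (x y : ℕ) (hx : x ∈ D.verts) (hy : y ∈ D.verts) (hxy : x ≠ y) :
    D.locLam x y ≤ D.lam := by
  apply le_csSup
  · refine ⟨∑ u ∈ D.verts, ∑ v ∈ D.verts, D.locLam u v, ?_⟩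
    rintro n ⟨u, hu, v, hv, _, rfl⟩
    exact (Finset.single_le_sum (f := fun v => D.locLam u v) (fun _ _ => Nat.zero_le _) hv).trans
      (Finset.single_le_sum (f := fun u => ∑ v ∈ D.verts, D.locLam u v)
        (fun _ _ => Nat.zero_le _) hu)
  · exact ⟨x, hx, y, hy, hxy, rfl⟩

def Col (k : ℕ) (D : Dgraph) : Prop := ∃ φ : ℕ → Fin k, D.IsDicolouring k φ

lemma chain_all {X : Finset ℕ} : ∀ (p : List ℕ), p.IsChain (fun a b => a ∈ X → b ∈ X) →
    (∀ x, p.head? = some x → x ∈ X) → ∀ z ∈ p, z ∈ X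
  | [], _, _ => by simp
  | [a], _, h => by simpa using h
  | a :: b :: t, hc, h => by
    rw [List.isChain_cons_cons] at hc
    have ha : a ∈ X := h a (by simp)
    have := chain_all (b :: t) hc.2 (by intro x hx; simp at hx; subst hx; exact hc.1 ha)
    intro z hz
    rcases List.mem_cons.1 hz with rfl | hz
    · exact ha
    · exact this z hz

lemma chain_last {X : Finset ℕ} : ∀ (p : List ℕ), p.IsChain (fun a b => a ∈ X → b ∈ X) →
    (∃ z ∈ p, z ∈ X) → ∀ y, p.getLast? = some y → y ∈ X
  | [], _, _ => by simp
  | [a], _, h => by simpa using h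
  | a :: b :: t, hc, h => by
    rw [List.isChain_cons_cons] at hc
    intro y hy
    rw [List.getLast?_cons_cons] at hy
    refine chain_last (b :: t) hc.2 ?_ y hy
    obtain ⟨z, hz, hzX⟩ := h
    rcases List.mem_cons.1 hz with rfl | hz
    · exact ⟨b, by simp, hc.1 hzX⟩
    · exact ⟨z, hz, hzX⟩

lemma chain_mem {r : ℕ → ℕ → Prop} : ∀ {p : List ℕ}, p.IsChain r →
    p.IsChain (fun a b => r a b ∧ a ∈ p ∧ b ∈ p)
  | [], _ => by simp
  | [a], _ => by simp
  | a :: b :: t, h => by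
    rw [List.isChain_cons_cons] at h ⊢
    refine ⟨⟨h.1, by simp, by simp⟩, ?_⟩
    exact (chain_mem h.2).imp fun x y hxy =>
      ⟨hxy.1, List.mem_cons_of_mem _ hxy.2.1, List.mem_cons_of_mem _ hxy.2.2⟩

lemma cycle_induce {D : Dgraph} {p : List ℕ} (hp : D.IsDicycle p) (S : Finset ℕ)
    (h : ∀ x ∈ p, x ∈ S) : (D.induce S).IsDicycle p := by
  obtain ⟨h1, h2, h3, h4, h5⟩ := hp
  refine ⟨h1, h2, ?_, ?_, ?_⟩
  · intro x hx; exact Finset.mem_inter.2 ⟨h3 x hx, h x hx⟩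
  · exact (chain_mem h4).imp fun a b hab =>
      Finset.mem_filter.2 ⟨hab.1, h a hab.2.1, h b hab.2.2⟩
  · intro x y hx hy
    exact Finset.mem_filter.2 ⟨h5 x y hx hy, h x (List.mem_of_getLast? hx),
      h y (List.mem_of_head? hy)⟩

lemma crit_cut (k : ℕ) (hk : 1 ≤ k) (H : Dgraph) (hn : ¬ Col k H) (X : Finset ℕ)
    (h1 : Col k (H.induce X)) (h2 : Col k (H.induce (H.verts \ X))) :
    (k : ℤ) ≤ ct H.arcs X := by
  obtain ⟨m, rfl⟩ : ∃ m, k = m + 1 := ⟨k - 1, by omega⟩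
  by_contra hlt
  rw [ct_card] at hlt
  push Not at hlt
  obtain ⟨φ1, hφ1⟩ := h1
  obtain ⟨φ2, hφ2⟩ := h2
  set F := H.arcs.filter fun a => a.1 ∈ X ∧ a.2 ∉ X with hF
  have hc : ∃ c : Fin (m + 1), c ∉ F.image fun a => φ1 a.1 - φ2 a.2 := by
    by_contra hcon
    push Not at hcon
    have e : (F.image fun a => φ1 a.1 - φ2 a.2) = Finset.univ :=
      Finset.eq_univ_iff_forall.2 hcon
    have := Finset.card_image_le (s := F) (f := fun a => φ1 a.1 - φ2 a.2)
    rw [e] at this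
    simp at this
    omega
  obtain ⟨c, hc⟩ := hc
  apply hn
  refine ⟨fun x => if x ∈ X then φ1 x else φ2 x + c, ?_⟩
  rintro p hp ⟨d, hd⟩
  have key : ∀ a b, a ∈ p → b ∈ p → (a, b) ∈ H.arcs → a ∈ X → b ∈ X := by
    intro a b ha hb hab haX
    by_contra hbX
    apply hc
    refine Finset.mem_image.2 ⟨(a, b), by simp [hF, hab, haX, hbX], ?_⟩
    have e1 := hd a ha
    have e2 := hd b hb
    simp [haX] at e1
    simp [hbX] at e2
    simp only [e1, ← e2]
    exact add_sub_cancel_left _ _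
  have hch : p.IsChain (fun a b => a ∈ X → b ∈ X) :=
    (chain_mem hp.2.2.2.1).imp fun a b hab => key a b hab.2.1 hab.2.2 hab.1
  by_cases hex : ∃ z ∈ p, z ∈ X
  · have hl := chain_last p hch hex
    have hall := chain_all p hch (by
      intro x hx
      have hne : p ≠ [] := by rintro rfl; simp at hx
      have hlast := List.getLast?_eq_some_getLast hne
      exact key _ x (List.getLast_mem hne) (List.mem_of_head? hx)
        (hp.2.2.2.2 _ _ hlast hx) (hl _ hlast))
    refine hφ1 p (cycle_induce hp X hall) ⟨d, fun x hx => ?_⟩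
    have := hd x hx
    simpa [hall x hx] using this
  · push Not at hex
    refine hφ2 p (cycle_induce hp _ fun x hx =>
      Finset.mem_sdiff.2 ⟨hp.2.2.1 x hx, hex x hx⟩) ⟨d - c, fun x hx => ?_⟩
    have := hd x hx
    simp [hex x hx] at this
    rw [← this]; exact (add_sub_cancel_right _ _).symm

lemma induce_WF {D : Dgraph} (h : D.WF) (S : Finset ℕ) : (D.induce S).WF := by
  intro a ha
  obtain ⟨ha, h1, h2⟩ := Finset.mem_filter.1 ha
  obtain ⟨g1, g2, g3⟩ := h a ha
  exact ⟨Finset.mem_inter.2 ⟨g1, h1⟩, Finset.mem_inter.2 ⟨g2, h2⟩, g3⟩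

lemma exists_crit (k : ℕ) (D : Dgraph) (hWF : D.WF) (hn : ¬ Col k D) :
    ∃ H : Dgraph, H.WF ∧ H.verts ⊆ D.verts ∧ H.arcs ⊆ D.arcs ∧ ¬ Col k H ∧
      ∀ H' : Dgraph, H'.WF → H'.verts ⊆ H.verts → H'.arcs ⊆ H.arcs →
        H'.verts.card + H'.arcs.card < H.verts.card + H.arcs.card → Col k H' := by
  have hex : ∃ n, ∃ H : Dgraph, (H.WF ∧ H.verts ⊆ D.verts ∧ H.arcs ⊆ D.arcs ∧ ¬ Col k H) ∧
      H.verts.card + H.arcs.card = n :=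
    ⟨_, D, ⟨hWF, subset_rfl, subset_rfl, hn⟩, rfl⟩
  classical
  obtain ⟨H, ⟨h1, h2, h3, h4⟩, hc⟩ := Nat.find_spec hex
  refine ⟨H, h1, h2, h3, h4, ?_⟩
  intro H' g1 g2 g3 g4
  by_contra g5
  rw [hc] at g4
  exact Nat.find_min hex g4 ⟨H', ⟨g1, g2.trans h2, g3.trans h3, g5⟩, rfl⟩

lemma crit_cut' (k : ℕ) (hk : 1 ≤ k) (H : Dgraph) (hWF : H.WF) (hn : ¬ Col k H)
    (hmin : ∀ H' : Dgraph, H'.WF → H'.verts ⊆ H.verts → H'.arcs ⊆ H.arcs →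
        H'.verts.card + H'.arcs.card < H.verts.card + H.arcs.card → Col k H')
    (X : Finset ℕ) (a b : ℕ) (ha : a ∈ H.verts) (hb : b ∈ H.verts) (haX : a ∈ X) (hbX : b ∉ X) :
    (k : ℤ) ≤ ct H.arcs X := by
  have aux : ∀ S : Finset ℕ, ∀ z ∈ H.verts, z ∉ S → Col k (H.induce S) := by
    intro S z hz hzS
    apply hmin _ (induce_WF hWF S) Finset.inter_subset_left (Finset.filter_subset _ _)
    have h1 : (H.induce S).arcs.card ≤ H.arcs.card := Finset.card_filter_le _ _
    have h2 : (H.induce S).verts.card < H.verts.card := by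
      apply Finset.card_lt_card
      refine (Finset.ssubset_iff_of_subset (s₁ := (H.induce S).verts)
        Finset.inter_subset_left).2 ?_
      exact ⟨z, hz, fun h => hzS (Finset.mem_inter.1 h).2⟩
    omega
  exact crit_cut k hk H hn X (aux X b hb hbX) (aux _ a ha (by simp [haX]))

lemma two_verts (k : ℕ) (hk : 1 ≤ k) (H : Dgraph) (hn : ¬ Col k H) (h : ℕ) :
    ∃ g ∈ H.verts, g ≠ h := by
  by_contra hcon
  push Not at hcon
  apply hn
  refine ⟨fun _ => ⟨0, hk⟩, ?_⟩
  rintro p ⟨h1, h2, h3, -⟩ -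
  match p with
  | [] => simp at h1
  | [a] => simp at h1
  | a :: b :: t =>
    have e1 := hcon a (h3 a (by simp))
    have e2 := hcon b (h3 b (by simp))
    simp [e1, e2] at h2

lemma ct_mono {A B : Finset (ℕ × ℕ)} (h : A ⊆ B) (X : Finset ℕ) : ct A X ≤ ct B X :=
  Finset.sum_le_sum_of_subset_of_nonneg h (fun _ _ _ => by split_ifs <;> simp)

/-- walks avoiding the arcs of `H` -/
def W (D H : Dgraph) : ℕ → ℕ → Prop :=
  Relation.ReflTransGen (fun a b => (a, b) ∈ D.arcs ∧ (a, b) ∉ H.arcs)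

lemma no_ear (k : ℕ) (D H : Dgraph) (hWF : D.WF) (hlam : D.lam = k)
    (hv : H.verts ⊆ D.verts) (ha : H.arcs ⊆ D.arcs)
    (hcut : ∀ (X : Finset ℕ) (a b : ℕ), a ∈ H.verts → b ∈ H.verts → a ∈ X → b ∉ X →
      (k : ℤ) ≤ ct H.arcs X)
    (x y : ℕ) (hx : x ∈ H.verts) (hy : y ∈ H.verts) (hw : W D H x y) : x = y := by
  by_contra hxy
  obtain ⟨X, hxX, hyX, hX⟩ := menger D hWF x y (hv hx) hxy
  have h1 := locLam_le D x y (hv hx) (hv hy) hxy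
  have h2 := hcut X x y hx hy hxX hyX
  have key : ∀ e ∈ D.arcs, e.1 ∈ X → e.2 ∉ X → e ∈ H.arcs := by
    intro e he e1 e2
    by_contra heH
    have h3 : ct (insert e H.arcs) X = 1 + ct H.arcs X := by
      unfold ct; rw [Finset.sum_insert heH]; simp [e1, e2]
    have h4 := ct_mono (Finset.insert_subset he ha) X
    have : (D.locLam x y : ℤ) ≤ k := by rw [← hlam]; exact_mod_cast h1
    omega
  have : ∀ z, W D H x z → z ∈ X := by
    intro z hz
    induction hz with
    | refl => exact hxX
    | tail _ hbc ih =>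
      by_contra hc
      exact hbc.2 (key _ hbc.1 ih hc)
  exact hyX (this y hw)

lemma reach_of_chain {r : ℕ → ℕ → Prop} : ∀ (p : List ℕ) (u v : ℕ), p.head? = some u →
    p.getLast? = some v → p.IsChain r → Relation.ReflTransGen r u v
  | [], _, _, h, _, _ => by simp at h
  | [a], u, v, h, h', _ => by
    simp at h h'; subst h; subst h'; exact Relation.ReflTransGen.refl
  | a :: b :: t, u, v, h, h', hc => by
    simp at h; subst h
    rw [List.getLast?_cons_cons] at h'
    rw [List.isChain_cons_cons] at hc
    exact (reach_of_chain (b :: t) b v (by simp) h' hc.2).head hc.1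

lemma strong_reach {D : Dgraph} (hs : D.Strong) {u v : ℕ} (hu : u ∈ D.verts) (hv : v ∈ D.verts) :
    Relation.ReflTransGen (fun a b => (a, b) ∈ D.arcs) u v := by
  by_cases h : u = v
  · subst h; exact Relation.ReflTransGen.refl
  · obtain ⟨p, hp⟩ := hs u hu v hv h
    exact reach_of_chain p u v hp.2.1 hp.2.2.1 hp.2.2.2.2

lemma W_to (D H : Dgraph) (hH : H.WF) (z y : ℕ) (hy : y ∈ H.verts)
    (h : Relation.ReflTransGen (fun a b => (a, b) ∈ D.arcs) z y) :
    ∃ g ∈ H.verts, W D H z g := by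
  induction h using Relation.ReflTransGen.head_induction_on with
  | refl => exact ⟨y, hy, Relation.ReflTransGen.refl⟩
  | head hac _ ih =>
    rename_i a c _
    by_cases ha : a ∈ H.verts
    · exact ⟨a, ha, Relation.ReflTransGen.refl⟩
    · obtain ⟨g, hg, hw⟩ := ih
      exact ⟨g, hg, hw.head ⟨hac, fun hh => ha (hH _ hh).1⟩⟩

lemma W_from (D H : Dgraph) (hH : H.WF) (y z : ℕ) (hy : y ∈ H.verts)
    (h : Relation.ReflTransGen (fun a b => (a, b) ∈ D.arcs) y z) :
    ∃ g ∈ H.verts, W D H g z := by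
  induction h with
  | refl => exact ⟨y, hy, Relation.ReflTransGen.refl⟩
  | tail _ hac ih =>
    rename_i a c _
    by_cases ha : c ∈ H.verts
    · exact ⟨c, ha, Relation.ReflTransGen.refl⟩
    · obtain ⟨g, hg, hw⟩ := ih
      exact ⟨g, hg, hw.tail ⟨hac, fun hh => ha (hH _ hh).2.1⟩⟩

lemma crit_eq (k : ℕ) (hk : 1 ≤ k) (D H : Dgraph) (hWF : D.WF) (hHWF : H.WF) (hlam : D.lam = k)
    (hv : H.verts ⊆ D.verts) (ha : H.arcs ⊆ D.arcs) (hn : ¬ Col k H)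
    (hcut : ∀ (X : Finset ℕ) (a b : ℕ), a ∈ H.verts → b ∈ H.verts → a ∈ X → b ∉ X →
      (k : ℤ) ≤ ct H.arcs X)
    (hs : D.Strong) (hb : D.Biconnected) : H = D := by
  have hear := no_ear k D H hWF hlam hv ha hcut
  obtain ⟨g0, hg0, -⟩ := two_verts k hk H hn 0
  have hverts : D.verts ⊆ H.verts := by
    intro z hz
    by_contra hzH
    obtain ⟨h, hh, hw1⟩ := W_to D H hHWF z g0 hg0 (strong_reach hs hz (hv hg0))
    obtain ⟨h', hh', hw2⟩ := W_from D H hHWF g0 z hg0 (strong_reach hs (hv hg0) hz)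
    have e : h' = h := hear h' h hh' hh (hw2.trans hw1)
    subst e
    obtain ⟨g, hg, hgh⟩ := two_verts k hk H hn h'
    have hcon : (D.delVert h').UConnected := by
      by_contra hc
      exact hb.2 h' ⟨hv hh', hc⟩
    have mem : ∀ w ∈ D.verts, w ≠ h' → w ∈ (D.delVert h').verts := by
      intro w hw hwh
      simp [Dgraph.delVert, Dgraph.induce, hw, hwh]
    have hr := hcon.2 z (mem z hz (fun e => hzH (e ▸ hh'))) g (mem g (hv hg) hgh)
    have inv : ∀ w, (D.delVert h').UReach z w → w ∉ H.verts ∧ W D H h' w ∧ W D H w h' := by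
      intro w hw
      induction hw with
      | refl => exact ⟨hzH, hw2, hw1⟩
      | tail _ hst ih =>
        rename_i b c _
        obtain ⟨i1, i2, i3⟩ := ih
        rcases hst with hst | hst
        · simp only [Dgraph.delVert, Dgraph.induce, Finset.mem_filter, Finset.mem_erase] at hst
          obtain ⟨s1, s2, s3⟩ := hst
          have hbc : W D H b c := Relation.ReflTransGen.single ⟨s1, fun q => i1 (hHWF _ q).1⟩
          have hc : c ∉ H.verts := fun q => s3.1 (hear h' c hh' q (i2.trans hbc)).symm
          obtain ⟨l, hl, hcl⟩ := W_to D H hHWF c g0 hg0 (strong_reach hs s3.2 (hv hg0))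
          have : h' = l := hear h' l hh' hl ((i2.trans hbc).trans hcl)
          exact ⟨hc, i2.trans hbc, this ▸ hcl⟩
        · simp only [Dgraph.delVert, Dgraph.induce, Finset.mem_filter, Finset.mem_erase] at hst
          obtain ⟨s1, s2, s3⟩ := hst
          have hbc : W D H c b := Relation.ReflTransGen.single ⟨s1, fun q => i1 (hHWF _ q).2.1⟩
          have hc : c ∉ H.verts := fun q => s2.1 (hear c h' q hh' (hbc.trans i3))
          obtain ⟨l, hl, hcl⟩ := W_from D H hHWF g0 c hg0 (strong_reach hs (hv hg0) s2.2)
          have : l = h' := hear l h' hl hh' (hcl.trans (hbc.trans i3))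
          exact ⟨hc, this ▸ hcl, hbc.trans i3⟩
    exact (inv g hr).1 hg
  have hve : H.verts = D.verts := Finset.Subset.antisymm hv hverts
  have hae : H.arcs = D.arcs := by
    apply Finset.Subset.antisymm ha
    rintro ⟨a, b⟩ hab
    by_contra hc
    obtain ⟨h1, h2, h3⟩ := hWF _ hab
    exact h3 (hear a b (hverts h1) (hverts h2) (Relation.ReflTransGen.single ⟨hab, hc⟩))
  cases H; cases D
  simp_all

lemma sum_bl_cut (A : Finset (ℕ × ℕ)) (V X : Finset ℕ)
    (hA : ∀ a ∈ A, a.1 ∈ V ∧ a.2 ∈ V) :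
    ∑ v ∈ X, bl A v = ct A X - ct A (V \ X) := by
  rw [sum_bl]
  unfold ct
  rw [← Finset.sum_sub_distrib]
  apply Finset.sum_congr rfl
  intro a ha
  obtain ⟨h1, h2⟩ := hA a ha
  by_cases c1 : a.1 ∈ X <;> by_cases c2 : a.2 ∈ X <;> simp [c1, c2, h1, h2]

lemma ct_inter (A : Finset (ℕ × ℕ)) (V X : Finset ℕ)
    (hA : ∀ a ∈ A, a.1 ∈ V ∧ a.2 ∈ V) : ct A (X ∩ V) = ct A X := by
  unfold ct
  apply Finset.sum_congr rfl
  intro a ha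
  obtain ⟨h1, h2⟩ := hA a ha
  simp [h1, h2]

lemma eulerian_aux (k : ℤ) (A : Finset (ℕ × ℕ)) (V : Finset ℕ)
    (hA : ∀ a ∈ A, a.1 ∈ V ∧ a.2 ∈ V)
    (hcut : ∀ (X : Finset ℕ) (a b : ℕ), a ∈ V → b ∈ V → a ∈ X → b ∉ X → k ≤ ct A X)
    (htight : ∀ a ∈ V, ∀ b ∈ V, a ≠ b → ∃ X, a ∈ X ∧ b ∉ X ∧ ct A X ≤ k) :
    ∀ v ∈ V, bl A v = 0 := by
  classical
  have hnn : ∀ v ∈ V, 0 ≤ bl A v := by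
    intro v hv
    have hT : ∀ u : ℕ, ∃ X : Finset ℕ, u ∈ V.erase v →
        (X ⊆ V.erase v ∧ u ∈ X ∧ ct A X = k ∧
          ∀ Y, Y ⊆ V.erase v → u ∈ Y → ct A Y = k → Y.card ≤ X.card) := by
      intro u
      by_cases hu : u ∈ V.erase v
      · obtain ⟨huv, huV⟩ := Finset.mem_erase.1 hu
        obtain ⟨X0, h1, h2, h3⟩ := htight u huV v hv huv
        have h4 := hcut X0 u v huV hv h1 h2
        obtain ⟨X, hX, hmax⟩ := Finset.exists_max_image
          ((V.erase v).powerset.filter fun Y => u ∈ Y ∧ ct A Y = k) Finset.card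
          ⟨X0 ∩ V, by
            simp only [Finset.mem_filter, Finset.mem_powerset]
            refine ⟨?_, by simp [h1, huV], by rw [ct_inter A V X0 hA]; omega⟩
            intro z hz
            obtain ⟨z1, z2⟩ := Finset.mem_inter.1 hz
            exact Finset.mem_erase.2 ⟨fun e => h2 (e ▸ z1), z2⟩⟩
        simp only [Finset.mem_filter, Finset.mem_powerset] at hX hmax
        exact ⟨X, fun _ => ⟨hX.1, hX.2.1, hX.2.2, fun Y a b c => hmax Y ⟨a, b, c⟩⟩⟩
      · exact ⟨∅, fun h => absurd h hu⟩
    choose T hT using hT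
    have hsub : ∀ u ∈ V.erase v, ∀ w ∈ V.erase v, ∀ z, z ∈ T u → z ∈ T w → T w ⊆ T u := by
      intro u hu w hw z hzu hzw
      obtain ⟨a1, a2, a3, a4⟩ := hT u hu
      obtain ⟨b1, b2, b3, b4⟩ := hT w hw
      have hvu : v ∉ T u := fun q => (Finset.mem_erase.1 (a1 q)).1 rfl
      have hvw : v ∉ T w := fun q => (Finset.mem_erase.1 (b1 q)).1 rfl
      have hzV : z ∈ V := (Finset.mem_erase.1 (a1 hzu)).2
      have c1 := hcut (T u ∪ T w) z v hzV hv (by simp [hzu]) (by simp [hvu, hvw])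
      have c2 := hcut (T u ∩ T w) z v hzV hv (by simp [hzu, hzw]) (by simp [hvu])
      have c3 := ct_submod A (T u) (T w)
      have c4 := a4 (T u ∪ T w) (Finset.union_subset a1 b1) (by simp [a2]) (by omega)
      have := Finset.eq_of_subset_of_card_le (Finset.subset_union_left (s₁ := T u) (s₂ := T w)) c4
      rw [this]; exact Finset.subset_union_right
    have hU : (V.erase v) = ((V.erase v).image T).biUnion id := by
      ext z
      simp only [Finset.mem_biUnion, Finset.mem_image, id]
      constructor
      · intro hz; exact ⟨T z, ⟨z, hz, rfl⟩, (hT z hz).2.1⟩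
      · rintro ⟨_, ⟨u, hu, rfl⟩, hz⟩; exact (hT u hu).1 hz
    have hneg : ∑ w ∈ V.erase v, bl A w ≤ 0 := by
      rw [hU, Finset.sum_biUnion]
      · apply Finset.sum_nonpos
        intro X hX
        obtain ⟨u, hu, rfl⟩ := Finset.mem_image.1 hX
        obtain ⟨a1, a2, a3, a4⟩ := hT u hu
        simp only [id]
        have hvu : v ∉ T u := fun q => (Finset.mem_erase.1 (a1 q)).1 rfl
        rw [sum_bl_cut A V (T u) hA, a3]
        have := hcut (V \ T u) v u hv (Finset.mem_erase.1 hu).2 (by simp [hv, hvu]) (by simp [a2])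
        omega
      · intro X hX Y hY hne
        obtain ⟨u, hu, rfl⟩ := Finset.mem_image.1 (Finset.mem_coe.1 hX)
        obtain ⟨w, hw, rfl⟩ := Finset.mem_image.1 (Finset.mem_coe.1 hY)
        rw [Function.onFun, id, id, Finset.disjoint_left]
        intro z z1 z2
        exact hne (Finset.Subset.antisymm (hsub w hw u hu z z2 z1) (hsub u hu w hw z z1 z2))
    have htot : ∑ w ∈ V, bl A w = 0 := by
      rw [sum_bl]
      apply Finset.sum_eq_zero
      intro a ha
      simp [hA a ha]
    rw [← Finset.add_sum_erase V _ hv] at htot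
    omega
  have htot : ∑ w ∈ V, bl A w = 0 := by
    rw [sum_bl]
    apply Finset.sum_eq_zero
    intro a ha
    simp [hA a ha]
  exact (Finset.sum_eq_zero_iff_of_nonneg hnn).1 htot

end Ext

/-- Lemma 4.1: a k-extremal digraph is Eulerian,
(k+1)-dicritical and satisfies λ(x,y) = k for every ordered pair of distinct
vertices; in particular the reverse of any minimum dicut is a minimum dicut. -/
theorem statement_3 (k : ℕ) (hk : 1 ≤ k) (D : Dgraph) (hWF : D.WF)
    (hext : Extremal k D) :
    D.Eulerian ∧ Dicritical (k + 1) D ∧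
    (∀ x ∈ D.verts, ∀ y ∈ D.verts, x ≠ y → D.locLam x y = k) ∧
    (∀ X, D.IsMinDicut X → D.IsMinDicut (D.verts \ X)) := by
  classical
  obtain ⟨hb, hs, hchi, hlam⟩ := hext
  have hn : ¬ Ext.Col k D := by
    intro h
    have : D.dichi ≤ k := Nat.sInf_le h
    omega
  obtain ⟨H, g1, g2, g3, g4, g5⟩ := Ext.exists_crit k D hWF hn
  have hcut := Ext.crit_cut' k hk H g1 g4 g5
  obtain rfl := Ext.crit_eq k hk D H hWF g1 hlam g2 g3 g4 hcut hs hb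
  have hloc : ∀ x ∈ H.verts, ∀ y ∈ H.verts, x ≠ y → H.locLam x y = k := by
    intro x hx y hy hxy
    obtain ⟨X, h1, h2, h3⟩ := Ext.menger H hWF x y hx hxy
    have h4 := hcut X x y hx hy h1 h2
    have h5 := Ext.locLam_le H x y hx hy hxy
    omega
  have hA : ∀ a ∈ H.arcs, a.1 ∈ H.verts ∧ a.2 ∈ H.verts := fun a ha =>
    ⟨(hWF a ha).1, (hWF a ha).2.1⟩
  have hbl := Ext.eulerian_aux k H.arcs H.verts hA hcut (by
    intro a ha b hb' hab
    obtain ⟨X, h1, h2, h3⟩ := Ext.menger H hWF a b ha hab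
    rw [hloc a ha b hb' hab] at h3
    exact ⟨X, h1, h2, h3⟩)
  refine ⟨?_, ⟨hchi, ?_⟩, hloc, ?_⟩
  · intro v hv
    have := hbl v hv
    unfold Ext.bl at this
    rw [Finset.sum_sub_distrib] at this
    unfold Dgraph.outdeg Dgraph.indeg
    rw [Finset.card_filter, Finset.card_filter]
    apply Nat.cast_injective (R := ℤ)
    push_cast
    linarith
  · intro a ha
    apply Nat.sInf_le
    show Ext.Col k _
    apply g5
    · intro b hb'
      exact hWF b (Finset.mem_sdiff.1 hb').1
    · exact subset_rfl
    · exact Finset.sdiff_subset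
    · have : (H.delArcs {a}).arcs.card < H.arcs.card := by
        apply Finset.card_lt_card
        refine (Finset.ssubset_iff_of_subset (s₁ := (H.delArcs {a}).arcs)
          Finset.sdiff_subset).2 ?_
        exact ⟨a, ha, by simp [Dgraph.delArcs]⟩
      have h2 : (H.delArcs {a}).verts = H.verts := rfl
      rw [h2]
      omega
  · rintro X ⟨⟨h1, h2, h3⟩, h4⟩
    have e := Ext.sum_bl_cut H.arcs H.verts X hA
    rw [Finset.sum_eq_zero (fun v hv => hbl v (h1 hv)), Ext.ct_card, Ext.ct_card] at e
    have e' : (H.dicutArcs X).card = (H.dicutArcs (H.verts \ X)).card := by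
      unfold Dgraph.dicutArcs
      omega
    refine ⟨⟨Finset.sdiff_subset, ?_, ?_⟩, fun Y hY => e' ▸ h4 Y hY⟩
    · rw [Finset.sdiff_nonempty]
      exact fun q => h3 (Finset.Subset.antisymm h1 q)
    · intro q
      obtain ⟨z, hz⟩ := h2
      have : z ∈ H.verts \ X := by rw [q]; exact h1 hz
      exact (Finset.mem_sdiff.1 this).2 hz
end

section
/- A digraph is 1-extremal if and only if it is a directed cycle. -/
open Dgraph

open Dgraph


namespace Dgraph

theorem dipath_of_reach (D : Dgraph) (hWF : D.WF) (A : Finset (ℕ × ℕ)) (hA : A ⊆ D.arcs)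
    (u v : ℕ) (hv : v ∈ D.verts)
    (h : Relation.ReflTransGen (fun a b => (a, b) ∈ A) u v) :
    ∃ p, D.IsDipath p u v ∧ arcsOf p ⊆ A := by
  suffices H : ∃ p : List ℕ, p.Nodup ∧ p.head? = some u ∧ p.getLast? = some v ∧
      (∀ x ∈ p, x ∈ D.verts) ∧ p.IsChain (fun a b => (a, b) ∈ A) by
    obtain ⟨p, h1, h2, h3, h4, h5⟩ := H
    refine ⟨p, ⟨h1, h2, h3, h4, h5.imp fun a b hab => hA hab⟩, ?_⟩
    clear h1 h2 h3 h4
    induction p with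
    | nil => simp [arcsOf]
    | cons a t ih =>
      cases t with
      | nil => simp [arcsOf]
      | cons b t =>
        rw [List.isChain_cons_cons] at h5
        have := ih h5.2
        simp only [arcsOf, List.tail_cons, List.zip_cons_cons, List.toFinset_cons] at this ⊢
        exact Finset.insert_subset h5.1 this
  induction h using Relation.ReflTransGen.head_induction_on with
  | refl => exact ⟨[v], by simp [hv]⟩
  | head hab hrt ih =>
    rename_i a b
    obtain ⟨p, h1, h2, h3, h4, h5⟩ := ih
    by_cases hap : a ∈ p
    · obtain ⟨s, t, rfl⟩ := List.append_of_mem hap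
      refine ⟨a :: t, h1.of_append_right, rfl, ?_, fun x hx => h4 x (by simp at hx ⊢; tauto),
        (List.isChain_append.1 h5).2.1⟩
      rw [← h3, List.getLast?_append]; simp [List.getLast?_cons]
    · cases p with
      | nil => simp at h2
      | cons c t =>
        simp at h2; subst h2
        refine ⟨a :: c :: t, List.nodup_cons.2 ⟨hap, h1⟩, rfl, ?_, ?_, ?_⟩
        · rw [← h3]; simp [List.getLast?_cons_cons]
        · intro x hx
          rcases List.mem_cons.1 hx with rfl | hx
          · exact (hWF _ (hA hab)).1
          · exact h4 x hx
        · exact List.isChain_cons_cons.2 ⟨hab, h5⟩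

theorem arcsOf_nonempty (D : Dgraph) (p : List ℕ) (u v : ℕ) (huv : u ≠ v) (h : D.IsDipath p u v) :
    ∃ w, (u, w) ∈ arcsOf p ∧ (u, w) ∈ D.arcs := by
  obtain ⟨h1, h2, h3, h4, h5⟩ := h
  match p, h2 with
  | [a], h2 => simp at h2 h3; omega
  | a :: b :: t, h2 =>
    simp at h2; subst h2
    exact ⟨b, by simp [arcsOf], (List.isChain_cons_cons.1 h5).1⟩

theorem loc_bound (D : Dgraph) (u v n : ℕ) (huv : u ≠ v) (P : Fin n → List ℕ)
    (hP : ∀ i, D.IsDipath (P i) u v)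
    (hd : Pairwise fun i j => Disjoint (arcsOf (P i)) (arcsOf (P j))) : n ≤ D.arcs.card := by
  choose w hw hw' using fun i => arcsOf_nonempty D (P i) u v huv (hP i)
  have := Finset.card_le_card_of_injOn (s := (Finset.univ : Finset (Fin n))) (t := D.arcs)
    (fun i => (u, w i)) (fun i _ => hw' i) (by
      intro i _ j _ hij
      by_contra hne
      exact Finset.disjoint_left.1 (hd hne) (hw i) (by
        have : (u, w i) = (u, w j) := hij
        rw [this]; exact hw j))
  simpa using this

theorem loc_bdd (D : Dgraph) (u v : ℕ) (huv : u ≠ v) :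
    BddAbove {n | ∃ P : Fin n → List ℕ, (∀ i, D.IsDipath (P i) u v) ∧
      Pairwise fun i j => Disjoint (arcsOf (P i)) (arcsOf (P j))} :=
  ⟨D.arcs.card, fun n ⟨P, h1, h2⟩ => loc_bound D u v n huv P h1 h2⟩

theorem loc_le (D : Dgraph) (u v : ℕ) (huv : u ≠ v) : D.locLam u v ≤ D.arcs.card :=
  csSup_le ⟨0, Fin.elim0, fun i => i.elim0, fun i => i.elim0⟩
    fun n ⟨P, h1, h2⟩ => loc_bound D u v n huv P h1 h2

theorem loc_le_lam (D : Dgraph) (u v : ℕ) (hu : u ∈ D.verts) (hv : v ∈ D.verts) (huv : u ≠ v) :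
    D.locLam u v ≤ D.lam := by
  refine le_csSup ⟨D.arcs.card, ?_⟩ ⟨u, hu, v, hv, huv, rfl⟩
  rintro n ⟨a, _, b, _, hab, rfl⟩
  exact loc_le D a b hab

theorem two_le_loc (D : Dgraph) (hWF : D.WF) (A B : Finset (ℕ × ℕ)) (hA : A ⊆ D.arcs)
    (hB : B ⊆ D.arcs) (hAB : Disjoint A B) (u v : ℕ) (hv : v ∈ D.verts) (huv : u ≠ v)
    (h1 : Relation.ReflTransGen (fun a b => (a, b) ∈ A) u v)
    (h2 : Relation.ReflTransGen (fun a b => (a, b) ∈ B) u v) : 2 ≤ D.locLam u v := by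
  obtain ⟨p, hp, hpA⟩ := dipath_of_reach D hWF A hA u v hv h1
  obtain ⟨q, hq, hqB⟩ := dipath_of_reach D hWF B hB u v hv h2
  have hd : Disjoint (arcsOf p) (arcsOf q) := hAB.mono hpA hqB
  refine le_csSup (loc_bdd D u v huv) ⟨![p, q], ?_, ?_⟩
  · intro i; fin_cases i
    · exact hp
    · exact hq
  · intro i j hij
    fin_cases i <;> fin_cases j
    · exact absurd rfl hij
    · exact hd
    · exact hd.symm
    · exact absurd rfl hij

/-- cyclic enumeration -/
def cy (p : List ℕ) (k : ℕ) : ℕ := p.getD (k % p.length) 0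

theorem cy_mem (p : List ℕ) (hp : 2 ≤ p.length) (k : ℕ) : cy p k ∈ p := by
  have : k % p.length < p.length := Nat.mod_lt _ (by omega)
  simp [cy, List.getD_eq_getElem?_getD, this]

theorem mem_cy (p : List ℕ) (x : ℕ) (hx : x ∈ p) : ∃ k < p.length, cy p k = x := by
  obtain ⟨k, hk, rfl⟩ := List.getElem_of_mem hx
  exact ⟨k, hk, by simp [cy, List.getD_eq_getElem?_getD, Nat.mod_eq_of_lt hk, hk]⟩

theorem cy_inj (p : List ℕ) (hp : 2 ≤ p.length) (hn : p.Nodup) (i j : ℕ)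
    (h : cy p i = cy p j) : i % p.length = j % p.length := by
  have hi : i % p.length < p.length := Nat.mod_lt _ (by omega)
  have hj : j % p.length < p.length := Nat.mod_lt _ (by omega)
  simp only [cy, List.getD_eq_getElem?_getD, List.getElem?_eq_getElem hi,
    List.getElem?_eq_getElem hj, Option.getD_some] at h
  exact (hn.getElem_inj_iff).1 h

theorem mem_cycArcs (p : List ℕ) (hp : 2 ≤ p.length) (a b : ℕ) :
    (a, b) ∈ cycArcs p ↔ ∃ k < p.length, a = cy p k ∧ b = cy p (k + 1) := by
  unfold cycArcs
  rw [List.mem_toFinset]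
  constructor
  · intro h
    obtain ⟨k, hk, hk2⟩ := List.getElem_of_mem h
    have hk' : k < p.length := by simp at hk; exact hk
    have hm : (k + 1) % p.length < p.length := Nat.mod_lt _ (by omega)
    simp only [List.getElem_zip, List.getElem_rotate, Prod.mk.injEq] at hk2
    refine ⟨k, hk', ?_, ?_⟩
    · simp [cy, List.getD_eq_getElem?_getD, Nat.mod_eq_of_lt hk', hk', hk2.1]
    · simp [cy, List.getD_eq_getElem?_getD, hm, hk2.2]
  · rintro ⟨k, hk, rfl, rfl⟩
    have hm : (k + 1) % p.length < p.length := Nat.mod_lt _ (by omega)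
    have hkz : k < (p.zip (p.rotate 1)).length := by simpa using hk
    have : (cy p k, cy p (k+1)) = (p.zip (p.rotate 1))[k] := by
      simp [cy, List.getD_eq_getElem?_getD, Nat.mod_eq_of_lt hk, hk, hm, List.getElem_rotate]
    rw [this]; exact List.getElem_mem _

theorem cy_mod (p : List ℕ) (k : ℕ) : cy p (k % p.length) = cy p k := by simp [cy]

theorem cy_congr (p : List ℕ) {i j : ℕ} (h : i % p.length = j % p.length) : cy p i = cy p j := by
  simp [cy, h]

theorem cy_arc (p : List ℕ) (hp : 2 ≤ p.length) (k : ℕ) : (cy p k, cy p (k+1)) ∈ cycArcs p := by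
  refine (mem_cycArcs p hp _ _).2 ⟨k % p.length, Nat.mod_lt _ (by omega), (cy_mod p k).symm, ?_⟩
  apply cy_congr; simp

theorem cy_shift (p : List ℕ) (x i : ℕ) (hx : x ∈ p) (hi : i ≤ p.length) :
    ∃ k < p.length, x = cy p (i + k) := by
  obtain ⟨j, hj, rfl⟩ := mem_cy p x hx
  refine ⟨(j + (p.length - i)) % p.length, Nat.mod_lt _ (by omega), ?_⟩
  apply cy_congr
  rw [Nat.add_mod_mod, show i + (j + (p.length - i)) = j + p.length by omega]
  simp

theorem cyc_reach (p : List ℕ) (hp : 2 ≤ p.length) (x y : ℕ) (hx : x ∈ p) (hy : y ∈ p) :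
    Relation.ReflTransGen (fun a b => (a, b) ∈ cycArcs p) x y := by
  obtain ⟨i, hi, rfl⟩ := mem_cy p x hx
  obtain ⟨k, -, rfl⟩ := cy_shift p y i hy hi.le
  clear hy
  induction k with
  | zero => exact .refl
  | succ k ih => exact ih.tail (cy_arc p hp _)

theorem cycArcs_mem (p : List ℕ) (hp : 2 ≤ p.length) (a b : ℕ) (h : (a, b) ∈ cycArcs p) :
    a ∈ p ∧ b ∈ p := by
  obtain ⟨k, -, rfl, rfl⟩ := (mem_cycArcs p hp a b).1 h
  exact ⟨cy_mem p hp _, cy_mem p hp _⟩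

theorem cycArcs_fun (p : List ℕ) (hp : 2 ≤ p.length) (hn : p.Nodup) (a b c : ℕ)
    (h : (a, b) ∈ cycArcs p) (h' : (a, c) ∈ cycArcs p) : b = c := by
  obtain ⟨k, hk, h1, rfl⟩ := (mem_cycArcs p hp a b).1 h
  obtain ⟨l, hl, h2, rfl⟩ := (mem_cycArcs p hp a c).1 h'
  have := cy_inj p hp hn k l (h1.symm.trans h2)
  apply cy_congr
  rw [Nat.add_mod, this, ← Nat.add_mod]

theorem dicycle_iff (D : Dgraph) (p : List ℕ) :
    D.IsDicycle p ↔ 2 ≤ p.length ∧ p.Nodup ∧ (∀ x ∈ p, x ∈ D.verts) ∧ cycArcs p ⊆ D.arcs := by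
  unfold IsDicycle
  refine and_congr_right fun hp => and_congr_right fun hn => and_congr_right fun hv => ?_
  have key : ∀ k (hk : k < p.length), cy p k = p[k] := fun k hk => by
    simp [cy, List.getD_eq_getElem?_getD, Nat.mod_eq_of_lt hk, hk]
  have k0 : cy p p.length = p[0] := by
    rw [← key 0 (by omega)]; apply cy_congr; simp
  have hlast : p.getLast? = some p[p.length - 1] := by
    rw [List.getLast?_eq_getElem?, List.getElem?_eq_getElem]
  have hhead : p.head? = some p[0] := by
    rw [List.head?_eq_getElem?, List.getElem?_eq_getElem]
  constructor
  · rintro ⟨h1, h2⟩ ⟨a, b⟩ hab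
    obtain ⟨k, hk, rfl, rfl⟩ := (mem_cycArcs p hp a b).1 hab
    by_cases hkl : k + 1 < p.length
    · rw [key k hk, key (k+1) hkl]
      exact List.isChain_iff_getElem.1 h1 k hkl
    · have hk' : k = p.length - 1 := by omega
      rw [show k + 1 = p.length by omega, k0, key k hk]
      apply h2 _ _ _ hhead
      subst hk'; exact hlast
  · intro h
    constructor
    · refine List.isChain_iff_getElem.2 fun k hk => ?_
      rw [← key k (by omega), ← key (k+1) hk]
      exact h (cy_arc p hp k)
    · intro x y hx hy
      rw [hlast] at hx; rw [hhead] at hy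
      obtain rfl := Option.some.inj hx
      obtain rfl := Option.some.inj hy
      rw [← k0, ← key _ (by omega)]
      have := h (cy_arc p hp (p.length - 1))
      rwa [show p.length - 1 + 1 = p.length by omega] at this

theorem reach_of_dipath (D : Dgraph) (p : List ℕ) (u v : ℕ) (h : D.IsDipath p u v) :
    Relation.ReflTransGen (fun a b => (a, b) ∈ D.arcs) u v := by
  obtain ⟨-, h2, h3, -, h5⟩ := h
  induction p generalizing u with
  | nil => simp at h2
  | cons a t ih =>
    simp at h2; subst h2
    cases t with
    | nil => simp at h3; subst h3; exact .refl
    | cons b t =>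
      have h5' := List.isChain_cons_cons.1 h5
      refine .head h5'.1 (ih b rfl ?_ h5'.2)
      rw [← h3, List.getLast?_cons_cons]

theorem forward (D : Dgraph) (hWF : D.WF) (h : Extremal 1 D) : IsDirectedCycleGraph D := by
  obtain ⟨⟨-, hbi⟩, hs, hchi, hlam⟩ := h
  have hcyc : ∃ p, D.IsDicycle p := by
    by_contra hno
    have : D.dichi ≤ 1 := Nat.sInf_le ⟨fun _ => 0, fun p hp => absurd ⟨p, hp⟩ hno⟩
    omega
  obtain ⟨p, hp⟩ := hcyc
  obtain ⟨hl, hn, hpv, hpa⟩ := (dicycle_iff D p).1 hp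
  have hreach : ∀ u ∈ D.verts, ∀ v ∈ D.verts,
      Relation.ReflTransGen (fun a b => (a, b) ∈ D.arcs) u v := by
    intro u hu v hv
    by_cases huv : u = v
    · subst huv; exact .refl
    · obtain ⟨q, hq⟩ := hs u hu v hv huv
      exact reach_of_dipath D q u v hq
  set B := D.arcs \ cycArcs p with hB
  set R := Relation.ReflTransGen (fun a b => (a, b) ∈ B) with hR
  have claim : ∀ x ∈ p, ∀ y ∈ p, R x y → x = y := by
    intro x hx y hy hxy
    by_contra hne
    have h2 := two_le_loc D hWF (cycArcs p) B hpa Finset.sdiff_subset Finset.disjoint_sdiff x y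
      (hpv y hy) hne (cyc_reach p hl x y hx hy) hxy
    have := loc_le_lam D x y (hpv x hx) (hpv y hy) hne
    omega
  obtain ⟨c0, hc0⟩ : ∃ c, c ∈ p := ⟨_, cy_mem p hl 0⟩
  have hfrom : ∀ z ∈ D.verts, ∃ c ∈ p, R c z := by
    intro z hz
    have := hreach c0 (hpv _ hc0) z hz
    induction this with
    | refl => exact ⟨c0, hc0, .refl⟩
    | tail hrt hbc ih =>
      rename_i b c
      by_cases hc : c ∈ p
      · exact ⟨c, hc, .refl⟩
      · obtain ⟨d, hd, hdb⟩ := ih (hWF _ hbc).1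
        exact ⟨d, hd, hdb.tail (Finset.mem_sdiff.2
          ⟨hbc, fun hh => hc (cycArcs_mem p hl _ _ hh).2⟩)⟩
  have hto : ∀ z ∈ D.verts, ∃ c ∈ p, R z c := by
    intro z hz
    have := hreach z hz c0 (hpv _ hc0)
    induction this using Relation.ReflTransGen.head_induction_on with
    | refl => exact ⟨c0, hc0, .refl⟩
    | head hbc hrt ih =>
      rename_i b c
      by_cases hb : b ∈ p
      · exact ⟨b, hb, .refl⟩
      · obtain ⟨d, hd, hdb⟩ := ih (hWF _ hbc).2.1
        exact ⟨d, hd, hdb.head (Finset.mem_sdiff.2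
          ⟨hbc, fun hh => hb (cycArcs_mem p hl _ _ hh).1⟩)⟩
  -- R-reachability to `x ∈ p` is invariant along arcs of `B`
  have inv1 : ∀ x ∈ p, ∀ a b, (a, b) ∈ B → R a x → R b x := by
    intro x hx a b hab ha
    obtain ⟨h1, h2, -⟩ := hWF (a, b) (Finset.mem_sdiff.1 hab).1
    obtain ⟨c, hc, hca⟩ := hfrom a h1
    obtain ⟨d, hd, hbd⟩ := hto b h2
    have e1 := claim c hc x hx (hca.trans ha)
    have e2 := claim c hc d hd ((hca.tail hab).trans hbd)
    rw [← e1, e2]; exact hbd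
  have hBe : B = ∅ := by
    by_contra hne
    obtain ⟨⟨a, b⟩, hab⟩ := Finset.nonempty_iff_ne_empty.2 hne
    obtain ⟨h1, h2, h3⟩ := hWF (a, b) (Finset.mem_sdiff.1 hab).1
    obtain ⟨x, hx, hax⟩ := hto a h1
    have hbx := inv1 x hx a b hab hax
    obtain ⟨y, hy, hyx, hyR⟩ : ∃ y ∈ D.verts, y ≠ x ∧ R y x := by
      by_cases hxa : a = x
      · exact ⟨b, h2, fun e => h3 (hxa.trans e.symm), hbx⟩
      · exact ⟨a, h1, hxa, hax⟩
    obtain ⟨c, hc, hcx⟩ : ∃ c ∈ p, c ≠ x := by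
      obtain ⟨k, hk, rfl⟩ := mem_cy p x hx
      refine ⟨cy p (k+1), cy_mem p hl _, fun e => ?_⟩
      exact (hWF _ (hpa (cy_arc p hl k))).2.2 e.symm
    have hconn : (D.delVert x).UConnected := by
      by_contra hh
      exact hbi x ⟨hpv x hx, hh⟩
    have hyc : (D.delVert x).UReach y c := hconn.2 y (by simp [delVert, induce, hy, hyx]) c
      (by simp [delVert, induce, hpv c hc, hcx])
    have : R c x := by
      clear hc hcx
      induction hyc with
      | refl => exact hyR
      | tail hrt hbc ih =>
        rename_i s t
        rcases hbc with hst | hst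
        · simp only [delVert, induce, Finset.mem_filter, Finset.mem_erase] at hst
          refine inv1 x hx s t (Finset.mem_sdiff.2 ⟨hst.1, fun hh => ?_⟩) ih
          exact hst.2.1.1 (claim s (cycArcs_mem p hl _ _ hh).1 x hx ih)
        · simp only [delVert, induce, Finset.mem_filter, Finset.mem_erase] at hst
          refine Relation.ReflTransGen.head (Finset.mem_sdiff.2 ⟨hst.1, fun hh => ?_⟩) ih
          exact hst.2.2.1 (claim s (cycArcs_mem p hl _ _ hh).2 x hx ih)
    exact hcx (claim c hc x hx this)
  refine ⟨p, hl, hn, ?_, ?_⟩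
  · ext z
    rw [List.mem_toFinset]
    refine ⟨fun hz => ?_, hpv z⟩
    obtain ⟨c, hc, hcz⟩ := hfrom z hz
    rcases Relation.ReflTransGen.cases_tail hcz with rfl | ⟨w, -, hw⟩
    · exact hc
    · simp [hBe] at hw
  · exact Finset.Subset.antisymm (Finset.sdiff_eq_empty_iff_subset.1 hBe) hpa

theorem backward (D : Dgraph) (hWF : D.WF) (h : IsDirectedCycleGraph D) : Extremal 1 D := by
  obtain ⟨p, hl, hn, hv, ha⟩ := h
  have hmem : ∀ x, x ∈ D.verts ↔ x ∈ p := fun x => by rw [hv, List.mem_toFinset]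
  have hreach : ∀ u ∈ D.verts, ∀ v ∈ D.verts,
      Relation.ReflTransGen (fun a b => (a, b) ∈ D.arcs) u v := by
    intro u hu v hv
    rw [ha]
    exact cyc_reach p hl u v ((hmem u).1 hu) ((hmem v).1 hv)
  have hs : D.Strong := by
    intro u hu v hv _
    obtain ⟨q, hq, -⟩ := dipath_of_reach D hWF D.arcs subset_rfl u v hv (hreach u hu v hv)
    exact ⟨q, hq⟩
  have h0 : cy p 0 ∈ D.verts := (hmem _).2 (cy_mem p hl 0)
  have h1 : cy p 1 ∈ D.verts := (hmem _).2 (cy_mem p hl 1)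
  have h01 : cy p 0 ≠ cy p 1 := by
    intro e
    have := cy_inj p hl hn 0 1 e
    rw [Nat.mod_eq_of_lt (by omega), Nat.mod_eq_of_lt (by omega)] at this
    omega
  refine ⟨⟨⟨⟨_, h0⟩, ?_⟩, ?_⟩, hs, ?_, ?_⟩
  · intro u hu v hv
    have hr := hreach u hu v hv
    induction hr with
    | refl => exact .refl
    | tail hrt hbc ih => exact (ih (hWF _ hbc).1).tail (Or.inl hbc)
  · rintro v ⟨hvD, hnc⟩
    apply hnc
    obtain ⟨i, hi, rfl⟩ := mem_cy p v ((hmem v).1 hvD)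
    have hne : ∀ k, k + 1 < p.length → cy p (i + 1 + k) ≠ cy p i := by
      intro k hk e
      have := cy_inj p hl hn _ _ e
      have h2 : (i + (1 + k)) ≡ i + 0 [MOD p.length] := by
        rw [← add_assoc]; exact this
      have h3 := Nat.ModEq.add_left_cancel' i h2
      unfold Nat.ModEq at h3
      rw [Nat.mod_eq_of_lt (by omega)] at h3
      simp at h3
    have hr : ∀ k, k + 1 < p.length → (D.delVert (cy p i)).UReach (cy p (i + 1)) (cy p (i + 1 + k)) := by
      intro k
      induction k with
      | zero => intro _; exact .refl
      | succ k ih =>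
        intro hk
        refine (ih (by omega)).tail (Or.inl ?_)
        have e1 := hne k (by omega)
        have e2 := hne (k+1) hk
        simp only [delVert, induce, Finset.mem_filter, Finset.mem_erase]
        refine ⟨?_, ⟨e1, (hmem _).2 (cy_mem p hl _)⟩, ⟨e2, (hmem _).2 (cy_mem p hl _)⟩⟩
        rw [ha]; exact cy_arc p hl _
    have hbase : ∀ x ∈ (D.delVert (cy p i)).verts, (D.delVert (cy p i)).UReach (cy p (i+1)) x := by
      intro x hx
      simp only [delVert, induce, Finset.mem_inter, Finset.mem_erase] at hx
      obtain ⟨k, hk, rfl⟩ := cy_shift p x (i+1) ((hmem x).1 hx.1) (by omega)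
      apply hr
      by_contra hlt
      apply hx.2.1
      have : k = p.length - 1 := by omega
      apply cy_congr
      rw [show i + 1 + k = i + p.length by omega]; simp
    refine ⟨⟨cy p (i + 1), ?_⟩, ?_⟩
    · have e := hne 0 (by omega)
      simp only [delVert, induce, Finset.mem_inter, Finset.mem_erase]
      exact ⟨(hmem _).2 (cy_mem p hl _), e, (hmem _).2 (cy_mem p hl _)⟩
    · intro u hu v hv
      have hsymm : ∀ a b, (D.delVert (cy p i)).UReach a b → (D.delVert (cy p i)).UReach b a := by
        intro a b hab
        induction hab with
        | refl => exact .refl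
        | tail hrt hbc ih => exact Relation.ReflTransGen.head (Or.symm hbc) ih
      exact Relation.ReflTransGen.trans (hsymm _ _ (hbase u hu)) (hbase v hv)
  · -- dichromatic number
    have hpc : D.IsDicycle p := (dicycle_iff D p).2 ⟨hl, hn, fun x hx => (hmem x).2 hx, ha.ge⟩
    have h2 : (2 : ℕ) ∈ {k | ∃ φ : ℕ → Fin k, D.IsDicolouring k φ} := by
      refine ⟨fun x => if x = cy p 0 then 0 else 1, ?_⟩
      rintro q hq ⟨c, hc⟩
      obtain ⟨ql, qn, qv, qa⟩ := (dicycle_iff D q).1 hq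
      have hall : ∀ x ∈ p, x ∈ q := by
        intro x hx
        have hst : cy q 0 ∈ q := cy_mem q ql 0
        have := hreach _ (qv _ hst) x ((hmem x).2 hx)
        induction this with
        | refl => exact hst
        | tail hrt hbc ih =>
          rename_i b c
          have hb := ih ((hmem b).1 (hWF _ hbc).1)
          obtain ⟨k, hk, rfl⟩ := mem_cy q b hb
          have e := qa (cy_arc q ql k)
          rw [ha] at e hbc
          rw [cycArcs_fun p hl hn _ _ _ hbc e]
          exact cy_mem q ql _
      have e0 := hc _ (hall _ (cy_mem p hl 0))
      have e1 := hc _ (hall _ (cy_mem p hl 1))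
      rw [← e1] at e0
      simp [h01.symm] at e0
    apply le_antisymm (Nat.sInf_le h2)
    refine le_csInf ⟨2, h2⟩ ?_
    rintro k ⟨φ, hφ⟩
    by_contra hk
    have hk1 : k ≤ 1 := by omega
    apply hφ p hpc
    refine ⟨φ 0, fun x _ => ?_⟩
    apply Fin.ext
    have := (φ x).2
    have := (φ 0).2
    omega
  · have hloc : ∀ u ∈ D.verts, ∀ v ∈ D.verts, u ≠ v → D.locLam u v = 1 := by
      intro u hu v hv huv
      apply le_antisymm
      · refine csSup_le ⟨0, Fin.elim0, fun i => i.elim0, fun i => i.elim0⟩ ?_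
        rintro n ⟨P, hP, hd⟩
        by_contra hn1
        obtain ⟨w, hw, hw'⟩ := arcsOf_nonempty D _ u v huv (hP ⟨0, by omega⟩)
        obtain ⟨z, hz, hz'⟩ := arcsOf_nonempty D _ u v huv (hP ⟨1, by omega⟩)
        rw [ha] at hw' hz'
        obtain rfl := cycArcs_fun p hl hn u w z hw' hz'
        exact Finset.disjoint_left.1 (hd (i := ⟨0, by omega⟩) (j := ⟨1, by omega⟩) (by simp)) hw hz
      · obtain ⟨q, hq⟩ := hs u hu v hv huv
        refine le_csSup (loc_bdd D u v huv) ⟨fun _ => q, fun _ => hq, fun i j hij => ?_⟩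
        exact absurd (Subsingleton.elim i j) hij
    have : {n | ∃ u ∈ D.verts, ∃ v ∈ D.verts, u ≠ v ∧ n = D.locLam u v} = {1} := by
      ext n
      constructor
      · rintro ⟨u, hu, v, hv, huv, rfl⟩
        exact hloc u hu v hv huv
      · rintro rfl
        exact ⟨_, h0, _, h1, h01, (hloc _ h0 _ h1 h01).symm⟩
    unfold lam
    rw [this]; simp

end Dgraph

/-- Theorem 4.2: a digraph is 1-extremal if and only if it is
a directed cycle. -/
theorem statement_4 (D : Dgraph) (hWF : D.WF) :
    Extremal 1 D ↔ IsDirectedCycleGraph D :=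
  ⟨forward D hWF, backward D hWF⟩
end

section
/- Let k ≥ 1, let D be a k-extremal digraph and let (A, Ā) be a minimum dicut of D. Then D/A or D/Ā is k-extremal, where D/X denotes the digraph obtained from D by contracting the set X into a single new vertex (deleting arcs inside X and identifying parallel arcs created by the contraction). -/
open Dgraph

open Dgraph

namespace S6

open Relation

/-- arcs leaving `X` -/
def cut (E : Finset (ℕ × ℕ)) (X : Finset ℕ) : Finset (ℕ × ℕ) :=
  E.filter fun a => a.1 ∈ X ∧ a.2 ∉ X

/-- net excess of a vertex -/
def exv (F : Finset (ℕ × ℕ)) (z : ℕ) : ℤ :=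
  ∑ a ∈ F, ((if a.1 = z then 1 else 0) - (if a.2 = z then 1 else 0))

/-- net excess of a set -/
def exs (F : Finset (ℕ × ℕ)) (X : Finset ℕ) : ℤ :=
  ∑ a ∈ F, ((if a.1 ∈ X then 1 else 0) - (if a.2 ∈ X then 1 else 0))

lemma cut_card (E : Finset (ℕ × ℕ)) (X : Finset ℕ) :
    ((cut E X).card : ℤ) = ∑ a ∈ E, (if a.1 ∈ X ∧ a.2 ∉ X then (1 : ℤ) else 0) := by
  rw [Finset.sum_boole]; rfl

lemma sum_exv (F : Finset (ℕ × ℕ)) (X : Finset ℕ) : ∑ x ∈ X, exv F x = exs F X := by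
  unfold exv exs
  rw [Finset.sum_comm]
  refine Finset.sum_congr rfl fun a _ => ?_
  rw [Finset.sum_sub_distrib]
  simp

/-- a nodup list witnessing reachability -/
lemma exists_path {r : ℕ → ℕ → Prop} {a b : ℕ} (h : ReflTransGen r a b) :
    ∃ p : List ℕ, p.Nodup ∧ p.head? = some a ∧ p.getLast? = some b ∧ p.IsChain r := by
  induction h using ReflTransGen.head_induction_on with
  | refl => exact ⟨[b], by simp⟩
  | @head a c hac _ ih =>
    obtain ⟨p, hn, hh, hl, hc⟩ := ih
    by_cases hap : a ∈ p
    · obtain ⟨s, t, rfl⟩ := List.append_of_mem hap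
      refine ⟨a :: t, ?_, by simp, ?_, ?_⟩
      · exact (List.nodup_append.1 hn).2.1
      · simpa [List.getLast?_append] using hl
      · exact (List.isChain_append.1 hc).2.1
    · refine ⟨a :: p, by simp [hap, hn], by simp, ?_, ?_⟩
      · cases p with
        | nil => simp at hh
        | cons x t => simpa [List.getLast?_cons_cons] using hl
      · cases p with
        | nil => simp at hh
        | cons x t =>
          simp at hh; subst hh
          simp [hac, hc]

lemma reach_of_path {r : ℕ → ℕ → Prop} {p : List ℕ} {a b : ℕ} (hh : p.head? = some a)
    (hl : p.getLast? = some b) (hc : p.IsChain r) : ReflTransGen r a b := by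
  induction p generalizing a with
  | nil => simp at hh
  | cons x t ih =>
    simp at hh; subst hh
    cases t with
    | nil => simp at hl; subst hl; exact .refl
    | cons y t =>
      simp at hc
      exact .head hc.1 (ih (by simp) (by simpa using hl) hc.2)

lemma arcsOf_cons (x y : ℕ) (t : List ℕ) :
    arcsOf (x :: y :: t) = insert (x, y) (arcsOf (y :: t)) := by
  simp [arcsOf]

lemma arcsOf_single (x : ℕ) : arcsOf [x] = ∅ := by simp [arcsOf]

lemma arcsOf_mem {p : List ℕ} {r : ℕ → ℕ → Prop} (hc : p.IsChain r) :
    ∀ e ∈ arcsOf p, r e.1 e.2 := by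
  induction p with
  | nil => simp [arcsOf]
  | cons x t ih =>
    cases t with
    | nil => simp [arcsOf]
    | cons y t =>
      simp at hc
      rw [arcsOf_cons]
      intro e he
      rcases Finset.mem_insert.1 he with rfl | he
      · exact hc.1
      · exact ih hc.2 e he

lemma arcsOf_cross {p : List ℕ} {u v : ℕ} (X : Finset ℕ) (hh : p.head? = some u)
    (hl : p.getLast? = some v) (hu : u ∈ X) (hv : v ∉ X) :
    ∃ e ∈ arcsOf p, e.1 ∈ X ∧ e.2 ∉ X := by
  induction p generalizing u with
  | nil => simp at hh
  | cons x t ih =>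
    simp at hh; subst hh
    cases t with
    | nil => simp at hl; subst hl; exact absurd hu hv
    | cons y t =>
      rw [arcsOf_cons]
      by_cases hy : y ∈ X
      · obtain ⟨e, he, h⟩ := ih (u := y) (by simp) (by simpa using hl) hy
        exact ⟨e, Finset.mem_insert_of_mem he, h⟩
      · exact ⟨(x, y), by simp, hu, hy⟩

lemma exv_insert {F : Finset (ℕ × ℕ)} {a : ℕ × ℕ} (h : a ∉ F) (z : ℕ) :
    exv (insert a F) z = exv F z + ((if a.1 = z then 1 else 0) - (if a.2 = z then 1 else 0)) := by
  unfold exv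
  rw [Finset.sum_insert h]; ring

lemma exv_erase {F : Finset (ℕ × ℕ)} {a : ℕ × ℕ} (h : a ∈ F) (z : ℕ) :
    exv (F.erase a) z = exv F z - ((if a.1 = z then 1 else 0) - (if a.2 = z then 1 else 0)) := by
  unfold exv
  rw [← Finset.sum_erase_add _ _ h]; ring

lemma augment (E : Finset (ℕ × ℕ)) (p : List ℕ) : ∀ (F : Finset (ℕ × ℕ)) (x y : ℕ), F ⊆ E →
    p.Nodup → p.head? = some x → p.getLast? = some y →
    p.IsChain (fun a b => ((a, b) ∈ E ∧ (a, b) ∉ F) ∨ (b, a) ∈ F) →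
    ∃ F' ⊆ E, ∀ z, exv F' z = exv F z + ((if x = z then 1 else 0) - (if y = z then 1 else 0)) := by
  induction p with
  | nil => intro F x y _ _ hh; simp at hh
  | cons w t ih =>
    intro F x y hF hn hh hl hc
    simp at hh; subst hh
    cases t with
    | nil => simp at hl; subst hl; exact ⟨F, hF, by simp⟩
    | cons x' t =>
      have hc1 := (List.isChain_cons_cons.1 hc).1
      have hc2 := (List.isChain_cons_cons.1 hc).2
      have hn1 := (List.nodup_cons.1 hn).1
      have hn2 := (List.nodup_cons.1 hn).2
      have key : ∃ F1 ⊆ E, (∀ a b, a ≠ w → b ≠ w → ((a, b) ∈ F1 ↔ (a, b) ∈ F)) ∧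
          ∀ z, exv F1 z = exv F z + ((if w = z then 1 else 0) - (if x' = z then 1 else 0)) := by
        rcases hc1 with ⟨h1, h2⟩ | h1
        · refine ⟨insert (w, x') F, ?_, ?_, ?_⟩
          · intro a ha
            rcases Finset.mem_insert.1 ha with rfl | ha
            · exact h1
            · exact hF ha
          · intro a b ha hb; simp [ha]
          · intro z; rw [exv_insert h2]
        · refine ⟨F.erase (x', w), ?_, ?_, ?_⟩
          · exact (Finset.erase_subset _ _).trans hF
          · intro a b ha hb; simp [hb]
          · intro z; rw [exv_erase h1]; ring
      obtain ⟨F1, hF1, hag, hex⟩ := key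
      have hc3 : (x' :: t).IsChain (fun a b => ((a, b) ∈ E ∧ (a, b) ∉ F1) ∨ (b, a) ∈ F1) := by
        have : ∀ l : List ℕ, w ∉ l →
            l.IsChain (fun a b => ((a, b) ∈ E ∧ (a, b) ∉ F) ∨ (b, a) ∈ F) →
            l.IsChain (fun a b => ((a, b) ∈ E ∧ (a, b) ∉ F1) ∨ (b, a) ∈ F1) := by
          intro l
          induction l with
          | nil => simp
          | cons a l ihl =>
            cases l with
            | nil => simp
            | cons b l =>
              intro hw hl
              rw [List.isChain_cons_cons] at hl ⊢
              simp at hw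
              refine ⟨?_, ihl (by simp; tauto) hl.2⟩
              rw [hag a b (by tauto) (by tauto), hag b a (by tauto) (by tauto)]
              exact hl.1
        exact this _ hn1 hc2
      obtain ⟨F', hF', h⟩ := ih F1 x' y hF1 hn2 (by simp) (by simpa using hl) hc3
      refine ⟨F', hF', fun z => ?_⟩
      rw [h, hex]; ring

lemma exv_sdiff_path (p : List ℕ) : ∀ (F : Finset (ℕ × ℕ)) (x y : ℕ),
    p.Nodup → p.head? = some x → p.getLast? = some y → p.IsChain (fun a b => (a, b) ∈ F) →
    ∀ z, exv (F \ arcsOf p) z =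
      exv F z - ((if x = z then 1 else 0) - (if y = z then 1 else 0)) := by
  induction p with
  | nil => intro F x y _ hh; simp at hh
  | cons w t ih =>
    intro F x y hn hh hl hc z
    simp at hh; subst hh
    cases t with
    | nil => simp at hl; subst hl; simp [arcsOf_single]
    | cons x' t =>
      have hc1 := (List.isChain_cons_cons.1 hc).1
      have hc2 := (List.isChain_cons_cons.1 hc).2
      have hn1 := (List.nodup_cons.1 hn).1
      have hn2 := (List.nodup_cons.1 hn).2
      have h3 : (x' :: t).IsChain (fun a b => (a, b) ∈ F.erase (w, x')) := by
        have : ∀ l : List ℕ, w ∉ l → l.IsChain (fun a b => (a, b) ∈ F) →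
            l.IsChain (fun a b => (a, b) ∈ F.erase (w, x')) := by
          intro l
          induction l with
          | nil => simp
          | cons a l ihl =>
            cases l with
            | nil => simp
            | cons b l =>
              intro hw hl
              rw [List.isChain_cons_cons] at hl ⊢
              simp at hw
              refine ⟨?_, ihl (by simp; tauto) hl.2⟩
              refine Finset.mem_erase.2 ⟨?_, hl.1⟩
              intro h; exact hw.1 (congrArg Prod.fst h).symm
        exact this _ hn1 hc2
      have := ih (F.erase (w, x')) x' y hn2 (by simp) (by simpa using hl) h3 z
      rw [arcsOf_cons, Finset.sdiff_insert, ← Finset.erase_sdiff_comm, this, exv_erase hc1]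
      ring

/-- flow decomposition -/
lemma decompose (u v : ℕ) (huv : u ≠ v) : ∀ (m : ℕ) (F : Finset (ℕ × ℕ)),
    exv F u = m → (∀ z, z ≠ u → z ≠ v → exv F z = 0) →
    ∃ P : Fin m → List ℕ, (∀ i, (P i).Nodup ∧ (P i).head? = some u ∧ (P i).getLast? = some v ∧
      (P i).IsChain (fun a b => (a, b) ∈ F)) ∧
      Pairwise fun i j => Disjoint (arcsOf (P i)) (arcsOf (P j)) := by
  classical
  intro m
  induction m with
  | zero => intro F _ _; exact ⟨fun i => i.elim0, fun i => i.elim0, fun i => i.elim0⟩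
  | succ m ih =>
    intro F hu hz
    have hreach : ReflTransGen (fun a b => (a, b) ∈ F) u v := by
      by_contra hcon
      let X : Finset ℕ := (insert u (F.image Prod.snd)).filter
        (fun x => ReflTransGen (fun a b => (a, b) ∈ F) u x)
      have huX : u ∈ X := by simp [X, ReflTransGen.refl]
      have hvX : v ∉ X := by simp [X]; tauto
      have h1 := sum_exv F X
      have h2 : ∑ x ∈ X, exv F x = m + 1 := by
        rw [Finset.sum_eq_single u]
        · rw [hu]; push_cast; rfl
        · intro b hb hbu; exact hz b hbu (by rintro rfl; exact hvX hb)
        · exact fun h => absurd huX h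
      have h3 : exs F X ≤ 0 := by
        unfold exs
        refine Finset.sum_nonpos fun a ha => ?_
        by_cases h : a.1 ∈ X
        · have : a.2 ∈ X := by
            simp only [X, Finset.mem_filter] at h ⊢
            refine ⟨Finset.mem_insert_of_mem (Finset.mem_image_of_mem _ ha), h.2.tail ha⟩
          simp [h, this]
        · simp only [h, if_false]; split_ifs <;> simp
      omega
    obtain ⟨p, hn, hh, hl, hc⟩ := exists_path hreach
    have hex := exv_sdiff_path p F u v hn hh hl hc
    obtain ⟨P, hP, hd⟩ := ih (F \ arcsOf p) (by rw [hex, hu]; simp [huv.symm])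
      (by intro z h1 h2; rw [hex, hz z h1 h2]; simp [h1.symm, h2.symm])
    refine ⟨Fin.cons p P, ?_, ?_⟩
    · intro i
      refine Fin.cases ?_ (fun i => ?_) i
      · exact ⟨hn, hh, hl, hc⟩
      · obtain ⟨a, b, c, d⟩ := hP i
        exact ⟨a, b, c, d.imp fun x y h => (Finset.mem_sdiff.1 h).1⟩
    · have hdis : ∀ i, Disjoint (arcsOf p) (arcsOf (P i)) := by
        intro i
        rw [Finset.disjoint_right]
        intro e he
        exact (Finset.mem_sdiff.1 (arcsOf_mem (hP i).2.2.2 e he)).2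
      intro i j
      refine Fin.cases ?_ (fun i => ?_) i <;> refine Fin.cases ?_ (fun j => ?_) j
      · intro h; exact absurd rfl h
      · intro _; simpa using hdis j
      · intro _; simpa using (hdis i).symm
      · intro h; simpa using hd (fun h' => h (by rw [h']))

/-- Menger's theorem, arc version -/
lemma menger (V : Finset ℕ) (E : Finset (ℕ × ℕ)) (hE : ∀ a ∈ E, a.1 ∈ V ∧ a.2 ∈ V)
    (u v : ℕ) (hu : u ∈ V) (huv : u ≠ v) (n : ℕ)
    (hcut : ∀ X ⊆ V, u ∈ X → v ∉ X → n ≤ (cut E X).card) :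
    ∃ P : Fin n → List ℕ, (∀ i, (P i).Nodup ∧ (P i).head? = some u ∧ (P i).getLast? = some v ∧
      (P i).IsChain (fun a b => (a, b) ∈ E)) ∧
      Pairwise fun i j => Disjoint (arcsOf (P i)) (arcsOf (P j)) := by
  classical
  have flow : ∀ m ≤ n, ∃ F ⊆ E, exv F u = m ∧ ∀ z, z ≠ u → z ≠ v → exv F z = 0 := by
    intro m
    induction m with
    | zero => intro _; exact ⟨∅, by simp, by simp [exv], by simp [exv]⟩
    | succ m ih =>
      intro hm
      obtain ⟨F, hF, hFu, hFz⟩ := ih (by omega)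
      have hreach : ReflTransGen
          (fun a b => ((a, b) ∈ E ∧ (a, b) ∉ F) ∨ (b, a) ∈ F) u v := by
        by_contra hcon
        let X : Finset ℕ := V.filter
          (fun x => ReflTransGen (fun a b => ((a, b) ∈ E ∧ (a, b) ∉ F) ∨ (b, a) ∈ F) u x)
        have huX : u ∈ X := by simp [X, ReflTransGen.refl, hu]
        have hvX : v ∉ X := by simp [X]; tauto
        have h1 := sum_exv F X
        have h2 : ∑ x ∈ X, exv F x = m := by
          rw [Finset.sum_eq_single u]
          · rw [hFu]
          · intro b hb hbu; exact hFz b hbu (by rintro rfl; exact hvX hb)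
          · exact fun h => absurd huX h
        have h3 : (cut E X).card ≤ exs F X := by
          have : cut E X ⊆ cut F X := by
            intro a ha
            simp only [cut, Finset.mem_filter] at ha ⊢
            refine ⟨?_, ha.2⟩
            by_contra haF
            apply ha.2.2
            have h1 := ha.2.1
            simp only [X, Finset.mem_filter] at h1 ⊢
            exact ⟨(hE a ha.1).2, h1.2.tail (Or.inl ⟨ha.1, haF⟩)⟩
          have h4 := Finset.card_le_card this
          have h5 : ((cut F X).card : ℤ) ≤ exs F X := by
            rw [cut_card]
            unfold exs
            refine Finset.sum_le_sum fun a ha => ?_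
            have : a.2 ∈ X → a.1 ∈ X := by
              intro h1
              simp only [X, Finset.mem_filter] at h1 ⊢
              exact ⟨(hE a (hF ha)).1, h1.2.tail (Or.inr ha)⟩
            by_cases h1 : a.1 ∈ X <;> by_cases h2 : a.2 ∈ X <;> simp_all
          omega
        have := hcut X (Finset.filter_subset _ _) huX hvX
        omega
      obtain ⟨p, hn, hh, hl, hc⟩ := exists_path hreach
      obtain ⟨F', hF', hex⟩ := augment E p F u v hF hn hh hl hc
      refine ⟨F', hF', ?_, ?_⟩
      · rw [hex, hFu]; simp [huv.symm]
      · intro z h1 h2; rw [hex, hFz z h1 h2]; simp [h1.symm, h2.symm]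
  obtain ⟨F, hF, hFu, hFz⟩ := flow n le_rfl
  obtain ⟨P, hP, hd⟩ := decompose u v huv n F hFu hFz
  exact ⟨P, fun i => ⟨(hP i).1, (hP i).2.1, (hP i).2.2.1, (hP i).2.2.2.imp fun _ _ h => hF h⟩, hd⟩

lemma tmono {r s : ℕ → ℕ → Prop} {x y : ℕ} (h : TransGen r x y)
    (hrs : ∀ a b, r a b → s a b) : TransGen s x y := by
  induction h with
  | single h => exact .single (hrs _ _ h)
  | tail _ h ih => exact ih.tail (hrs _ _ h)

lemma paths_le_cut (D : Dgraph) (u v : ℕ) (X : Finset ℕ) (hu : u ∈ X) (hv : v ∉ X) (n : ℕ)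
    (P : Fin n → List ℕ) (hP : ∀ i, D.IsDipath (P i) u v)
    (hd : Pairwise fun i j => Disjoint (arcsOf (P i)) (arcsOf (P j))) :
    n ≤ (cut D.arcs X).card := by
  have h : ∀ i, ∃ e ∈ arcsOf (P i), e.1 ∈ X ∧ e.2 ∉ X := fun i =>
    arcsOf_cross X (hP i).2.1 (hP i).2.2.1 hu hv
  choose e he hX using h
  have hinj : Function.Injective e := by
    intro i j hij
    by_contra hne
    exact Finset.disjoint_left.1 (hd hne) (he i) (hij ▸ he j)
  have hmem : ∀ i, e i ∈ cut D.arcs X := by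
    intro i
    refine Finset.mem_filter.2 ⟨?_, hX i⟩
    exact arcsOf_mem (r := fun a b => (a, b) ∈ D.arcs) (hP i).2.2.2.2 _ (he i)
  have := Finset.card_le_card (s := Finset.univ.image e) (t := cut D.arcs X)
    (by intro x hx; obtain ⟨i, _, rfl⟩ := Finset.mem_image.1 hx; exact hmem i)
  rwa [Finset.card_image_of_injective _ hinj, Finset.card_univ, Fintype.card_fin] at this

lemma locLam_le (D : Dgraph) (u v : ℕ) (X : Finset ℕ) (hu : u ∈ X) (hv : v ∉ X) :
    D.locLam u v ≤ (cut D.arcs X).card := by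
  refine csSup_le' ?_
  rintro n ⟨P, hP, hd⟩
  exact paths_le_cut D u v X hu hv n P hP hd

lemma le_locLam (D : Dgraph) (u v : ℕ) (huv : u ≠ v) (n : ℕ)
    (P : Fin n → List ℕ) (hP : ∀ i, D.IsDipath (P i) u v)
    (hd : Pairwise fun i j => Disjoint (arcsOf (P i)) (arcsOf (P j))) : n ≤ D.locLam u v := by
  refine le_csSup ⟨(cut D.arcs {u}).card, ?_⟩ ⟨P, hP, hd⟩
  rintro n ⟨P, hP, hd⟩
  exact paths_le_cut D u v {u} (by simp) (by simpa using huv.symm) n P hP hd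

lemma locLam_le_lam (D : Dgraph) (u v : ℕ) (hu : u ∈ D.verts) (hv : v ∈ D.verts)
    (huv : u ≠ v) : D.locLam u v ≤ D.lam := by
  refine le_csSup ⟨D.arcs.card, ?_⟩ ⟨u, hu, v, hv, huv, rfl⟩
  rintro n ⟨u, _, v, _, huv, rfl⟩
  exact (locLam_le D u v {u} (by simp) (by simpa using huv.symm)).trans
    (Finset.card_le_card (Finset.filter_subset _ _))

lemma lam_le (D : Dgraph) (k : ℕ) (h : ∀ u ∈ D.verts, ∀ v ∈ D.verts, u ≠ v →
    ∃ X : Finset ℕ, u ∈ X ∧ v ∉ X ∧ (cut D.arcs X).card ≤ k) : D.lam ≤ k := by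
  refine csSup_le' ?_
  rintro n ⟨u, hu, v, hv, huv, rfl⟩
  obtain ⟨X, h1, h2, h3⟩ := h u hu v hv huv
  exact (locLam_le D u v X h1 h2).trans h3

/-- paths of a list with arcs in `E` visit only vertices of `D` -/
lemma isDipath_of (D : Dgraph) (hWF : D.WF) (u v : ℕ) (hu : u ∈ D.verts) (p : List ℕ)
    (hn : p.Nodup) (hh : p.head? = some u) (hl : p.getLast? = some v)
    (hc : p.IsChain (fun a b => (a, b) ∈ D.arcs)) : D.IsDipath p u v := by
  refine ⟨hn, hh, hl, ?_, hc⟩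
  clear hn hl
  induction p generalizing u with
  | nil => simp
  | cons x t ih =>
    simp at hh; subst hh
    cases t with
    | nil => simpa using hu
    | cons y t =>
      rw [List.isChain_cons_cons] at hc
      intro z hz
      rcases List.mem_cons.1 hz with rfl | hz
      · exact hu
      · exact ih y (hWF _ hc.1).2.1 (by simp) hc.2 z hz

lemma exists_cut (D : Dgraph) (hWF : D.WF) (u v : ℕ) (hu : u ∈ D.verts) (hv : v ∈ D.verts)
    (huv : u ≠ v) (k : ℕ) (hk : D.lam ≤ k) :
    ∃ X ⊆ D.verts, u ∈ X ∧ v ∉ X ∧ (cut D.arcs X).card ≤ k := by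
  by_contra hcon
  push Not at hcon
  obtain ⟨P, hP, hd⟩ := menger D.verts D.arcs (fun a ha => ⟨(hWF a ha).1, (hWF a ha).2.1⟩)
    u v hu huv (k + 1) (fun X h1 h2 h3 => hcon X h1 h2 h3)
  have h1 := le_locLam D u v huv (k + 1) P (fun i => isDipath_of D hWF u v hu (P i) (hP i).1
    (hP i).2.1 (hP i).2.2.1 (hP i).2.2.2) hd
  have h2 := locLam_le_lam D u v hu hv huv
  omega

/-- monochromatic arc relation -/
def mono {k : ℕ} (E : Finset (ℕ × ℕ)) (φ : ℕ → Fin k) (a b : ℕ) : Prop :=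
  (a, b) ∈ E ∧ φ a = φ b

def Good {k : ℕ} (E : Finset (ℕ × ℕ)) (φ : ℕ → Fin k) : Prop :=
  ∀ x, ¬ TransGen (mono E φ) x x

def Col (E : Finset (ℕ × ℕ)) (k : ℕ) : Prop := ∃ φ : ℕ → Fin k, Good E φ

lemma mono_reach_eq {k : ℕ} {E : Finset (ℕ × ℕ)} {φ : ℕ → Fin k} {a b : ℕ}
    (h : ReflTransGen (mono E φ) a b) : φ a = φ b := by
  induction h with
  | refl => rfl
  | tail _ h ih => exact ih.trans h.2

lemma dicol_iff (D : Dgraph) (hWF : D.WF) (k : ℕ) (φ : ℕ → Fin k) :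
    D.IsDicolouring k φ ↔ Good D.arcs φ := by
  constructor
  · intro h x hx
    obtain ⟨y, hxy, hyx⟩ := TransGen.head'_iff.1 hx
    obtain ⟨p, hn, hh, hl, hc⟩ := exists_path hyx
    have hne := (hWF _ hxy.1).2.2
    have hdp := isDipath_of D hWF y x (hWF _ hxy.1).2.1 p hn hh hl (hc.imp fun _ _ h => h.1)
    refine h p ⟨?_, hn, hdp.2.2.2.1, hdp.2.2.2.2, ?_⟩ ⟨φ y, ?_⟩
    · match p, hh, hl with
      | [], hh, _ => simp at hh
      | [z], hh, hl =>
        simp at hh hl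
        exact absurd (hl.symm.trans hh) hne
      | _ :: _ :: _, _, _ => simp
    · intro a b ha hb
      rw [hl] at ha; rw [hh] at hb
      simp at ha hb
      subst ha hb
      exact hxy.1
    · clear hl hdp hxy hyx hne hn
      induction p generalizing y with
      | nil => simp
      | cons a t ih =>
        simp at hh; subst hh
        cases t with
        | nil => simp
        | cons b t =>
          rw [List.isChain_cons_cons] at hc
          intro z hz
          rcases List.mem_cons.1 hz with rfl | hz
          · rfl
          · rw [ih b (by simp) hc.2 z hz]; exact hc.1.2.symm
  · rintro h p ⟨hlen, hn, hv, hc, hcl⟩ ⟨c, hcol⟩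
    match p, hlen, hc, hcl, hcol with
    | a :: t, hlen, hc, hcl, hcol =>
      have hl : (a :: t).getLast? = some ((a :: t).getLast (by simp)) :=
        List.getLast?_eq_getLast_of_ne_nil _
      have harc := hcl _ a hl (by simp)
      have hchain : (a :: t).IsChain (mono D.arcs φ) := by
        clear hlen hcl hl harc hn hv
        generalize a :: t = l at hc hcol
        induction l with
        | nil => simp
        | cons x l ih =>
          cases l with
          | nil => simp
          | cons y l =>
            have hc' := List.isChain_cons_cons.1 hc
            rw [List.isChain_cons_cons]
            refine ⟨⟨hc'.1, ?_⟩, ih hc'.2 (fun z hz => hcol z (by simp at hz ⊢; tauto))⟩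
            rw [hcol x (by simp), hcol y (by simp)]
      have hr := reach_of_path (a := a) (by simp) hl hchain
      refine h a (TransGen.tail' hr ⟨harc, ?_⟩)
      rw [hcol _ (List.getLast_mem _), hcol a (by simp)]

lemma col_mono {E : Finset (ℕ × ℕ)} {j k : ℕ} (hjk : j ≤ k) (h : Col E j) : Col E k := by
  obtain ⟨φ, hφ⟩ := h
  refine ⟨fun x => Fin.castLE hjk (φ x), fun x hx => hφ x ?_⟩
  refine tmono hx ?_
  rintro a b ⟨h1, h2⟩
  exact ⟨h1, Fin.castLE_injective hjk h2⟩

lemma not_col_of_dichi (D : Dgraph) (hWF : D.WF) (k : ℕ) (h : k < D.dichi) : ¬ Col D.arcs k := by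
  rintro ⟨φ, hφ⟩
  exact Nat.notMem_of_lt_sInf h ⟨φ, (dicol_iff D hWF k φ).2 hφ⟩

lemma dichi_eq (D : Dgraph) (hWF : D.WF) (k : ℕ) (h1 : Col D.arcs (k + 1))
    (h2 : ¬ Col D.arcs k) : D.dichi = k + 1 := by
  have hmem : k + 1 ∈ {k | ∃ φ : ℕ → Fin k, D.IsDicolouring k φ} := by
    obtain ⟨φ, hφ⟩ := h1
    exact ⟨φ, (dicol_iff D hWF _ φ).2 hφ⟩
  refine le_antisymm (Nat.sInf_le hmem) ?_
  refine le_csInf ⟨_, hmem⟩ ?_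
  rintro j ⟨φ, hφ⟩
  by_contra hj
  exact h2 (col_mono (by omega) ⟨φ, (dicol_iff D hWF _ φ).1 hφ⟩)

/-- every step of a closed walk lies on it -/
lemma loop_loc {r : ℕ → ℕ → Prop} {x y : ℕ} (h : TransGen r x y) :
    TransGen (fun p q => r p q ∧ ReflTransGen r x p ∧ ReflTransGen r q y) x y := by
  induction h with
  | single h => exact .single ⟨h, .refl, .refl⟩
  | @tail b c hb hbc ih =>
    refine TransGen.tail (tmono ih ?_) ⟨hbc, hb.to_reflTransGen, .refl⟩
    rintro p q ⟨h1, h2, h3⟩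
    exact ⟨h1, h2, h3.tail hbc⟩

/-- closed walk either never crosses or crosses on it from `P` to `¬P` -/
lemma loop_cross {r : ℕ → ℕ → Prop} {x : ℕ} (P : ℕ → Prop) (h : TransGen r x x) :
    (∃ p q, r p q ∧ ReflTransGen r x p ∧ ReflTransGen r q x ∧ P p ∧ ¬ P q) ∨
    TransGen (fun p q => r p q ∧ P p ∧ P q) x x ∨
    TransGen (fun p q => r p q ∧ ¬ P p ∧ ¬ P q) x x := by
  by_cases hc : ∃ p q, r p q ∧ ReflTransGen r x p ∧ ReflTransGen r q x ∧ P p ∧ ¬ P q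
  · exact Or.inl hc
  right
  push Not at hc
  have hfw : ∀ z, ReflTransGen r x z → ReflTransGen r z x → P x → P z := by
    intro z hz
    induction hz with
    | refl => exact fun _ h => h
    | @tail b c hb hbc ih =>
      intro hcx hx
      exact hc b c hbc hb hcx (ih (.head hbc hcx) hx)
  have hbw : ∀ z, ReflTransGen r z x → ReflTransGen r x z → P z → P x := by
    intro z hz
    induction hz using ReflTransGen.head_induction_on with
    | refl => exact fun _ h => h
    | @head b c hbc hcx ih =>
      intro hxb hb
      exact ih (hxb.tail hbc) (hc b c hbc hxb hcx hb)
  have hl := loop_loc h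
  by_cases hx : P x
  · left
    refine tmono hl ?_
    rintro p q ⟨h1, h2, h3⟩
    exact ⟨h1, hfw p h2 (.head h1 h3) hx, hfw q (h2.tail h1) h3 hx⟩
  · right
    refine tmono hl ?_
    rintro p q ⟨h1, h2, h3⟩
    exact ⟨h1, fun h => hx (hbw p (.head h1 h3) h2 h), fun h => hx (hbw q h3 (h2.tail h1) h)⟩

/-- arcs induced by a set -/
def ind (E : Finset (ℕ × ℕ)) (V : Finset ℕ) : Finset (ℕ × ℕ) :=
  E.filter fun a => a.1 ∈ V ∧ a.2 ∈ V

lemma combine_small {k : ℕ} (E : Finset (ℕ × ℕ)) (V X : Finset ℕ)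
    (h1 : Col (ind E X) k) (h2 : Col (ind E (V \ X)) k)
    (hcut : (cut (ind E V) X).card < k) : Col (ind E V) k := by
  classical
  obtain ⟨φ, hφ⟩ := h1
  obtain ⟨ψ, hψ⟩ := h2
  have : NeZero k := ⟨by omega⟩
  obtain ⟨j, hj⟩ : ∃ j : Fin k, j ∉ (cut (ind E V) X).image (fun e => φ e.1 - ψ e.2) := by
    by_contra hcon
    push Not at hcon
    have h3 : (Finset.univ : Finset (Fin k)) ⊆ (cut (ind E V) X).image (fun e => φ e.1 - ψ e.2) :=
      fun j _ => hcon j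
    have h4 := Finset.card_le_card h3
    have h5 := Finset.card_image_le (s := cut (ind E V) X) (f := fun e => φ e.1 - ψ e.2)
    rw [Finset.card_univ, Fintype.card_fin] at h4
    omega
  refine ⟨fun x => if x ∈ X then φ x else j + ψ x, fun x hx => ?_⟩
  rcases loop_cross (· ∈ X) hx with ⟨p, q, ⟨h1, h2⟩, -, -, h3, h4⟩ | h | h
  · apply hj
    refine Finset.mem_image.2 ⟨(p, q), Finset.mem_filter.2 ⟨h1, h3, h4⟩, ?_⟩
    simp only [h3, h4, if_true, if_false] at h2
    rw [h2]; simp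
  · refine hφ x (tmono h ?_)
    rintro a b ⟨⟨h1, h2⟩, h3, h4⟩
    simp only [h3, h4, if_true] at h2
    exact ⟨Finset.mem_filter.2 ⟨(Finset.mem_filter.1 h1).1, h3, h4⟩, h2⟩
  · refine hψ x (tmono h ?_)
    rintro a b ⟨⟨h1, h2⟩, h3, h4⟩
    simp only [h3, h4, if_false] at h2
    have h5 := Finset.mem_filter.1 h1
    exact ⟨Finset.mem_filter.2 ⟨h5.1, by simp [h3, h5.2], by simp [h4, h5.2]⟩, add_left_cancel h2⟩

/-- a vertex set inducing a subdigraph all of whose dicuts are large -/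
lemma critical (D : Dgraph) (hWF : D.WF) (k : ℕ) (hk : 1 ≤ k) (h : ¬ Col D.arcs k) :
    ∃ V ⊆ D.verts, V.Nontrivial ∧
      ∀ X ⊆ V, X.Nonempty → X ≠ V → k ≤ (cut (ind D.arcs V) X).card := by
  classical
  have hV : ind D.arcs D.verts = D.arcs := by
    refine Finset.filter_true_of_mem fun a ha => ⟨(hWF a ha).1, (hWF a ha).2.1⟩
  let S := D.verts.powerset.filter fun V => ¬ Col (ind D.arcs V) k
  have hS : S.Nonempty := ⟨D.verts, by simp [S, hV, h]⟩
  obtain ⟨V, hVS, hmin⟩ := Finset.exists_min_image S Finset.card hS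
  simp only [S, Finset.mem_filter, Finset.mem_powerset] at hVS hmin
  have hsub : ∀ W ⊆ V, W ≠ V → Col (ind D.arcs W) k := by
    intro W hW hne
    by_contra hcon
    have h1 := hmin W ⟨hW.trans hVS.1, hcon⟩
    exact hne (Finset.eq_of_subset_of_card_le hW h1)
  refine ⟨V, hVS.1, ?_, ?_⟩
  · by_contra hnt
    apply hVS.2
    refine ⟨fun _ => ⟨0, by omega⟩, fun x hx => ?_⟩
    obtain ⟨y, hxy, -⟩ := TransGen.head'_iff.1 hx
    have h1 := Finset.mem_filter.1 hxy.1
    exact (hWF _ h1.1).2.2 (by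
      by_contra hne
      exact hnt ⟨x, h1.2.1, y, h1.2.2, hne⟩)
  · intro X hX hne hXV
    by_contra hlt
    push Not at hlt
    apply hVS.2
    refine combine_small D.arcs V X (hsub X hX hXV) (hsub _ Finset.sdiff_subset ?_) hlt
    intro heq
    obtain ⟨x, hx⟩ := hne
    have : x ∈ V \ X := by rw [heq]; exact hX hx
    exact (Finset.mem_sdiff.1 this).2 hx

lemma le_lam_of_not_col (D : Dgraph) (hWF : D.WF) (k : ℕ) (hk : 1 ≤ k) (h : ¬ Col D.arcs k) :
    k ≤ D.lam := by
  obtain ⟨V, hV, ⟨u, hu, v, hv, huv⟩, hcut⟩ := critical D hWF k hk h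
  obtain ⟨P, hP, hd⟩ := menger V (ind D.arcs V) (fun a ha => (Finset.mem_filter.1 ha).2)
    u v hu huv k (fun X h1 h2 h3 => hcut X h1 ⟨u, h2⟩ (by rintro rfl; exact h3 hv))
  have h1 := le_locLam D u v huv k P (fun i => isDipath_of D hWF u v (hV hu) (P i) (hP i).1
    (hP i).2.1 (hP i).2.2.1 ((hP i).2.2.2.imp fun _ _ h => (Finset.mem_filter.1 h).1)) hd
  exact h1.trans (locLam_le_lam D u v (hV hu) (hV hv) huv)

lemma reach_cross {r : ℕ → ℕ → Prop} {x y : ℕ} (h : ReflTransGen r x y) (X : Finset ℕ)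
    (hx : x ∈ X) (hy : y ∉ X) : ∃ p q, r p q ∧ p ∈ X ∧ q ∉ X := by
  by_contra hcon
  push Not at hcon
  have : y ∈ X := by
    clear hy
    induction h with
    | refl => exact hx
    | tail _ hbc ih => exact hcon _ _ hbc ih
  exact hy this

lemma strong_reach (D : Dgraph) (hs : D.Strong) (u v : ℕ) (hu : u ∈ D.verts) (hv : v ∈ D.verts) :
    ReflTransGen (fun a b => (a, b) ∈ D.arcs) u v := by
  by_cases h : u = v
  · subst h; exact .refl
  · obtain ⟨p, hp⟩ := hs u hu v hv h
    exact reach_of_path hp.2.1 hp.2.2.1 hp.2.2.2.2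

/-- every dicut of an extremal digraph has at least `k` arcs -/
lemma all_cuts (D : Dgraph) (hWF : D.WF) (k : ℕ) (hk : 1 ≤ k) (hb : D.Biconnected)
    (hs : D.Strong) (hcol : ¬ Col D.arcs k) (hlam : D.lam ≤ k) :
    ∀ X ⊆ D.verts, X.Nonempty → X ≠ D.verts → k ≤ (cut D.arcs X).card := by
  classical
  obtain ⟨V, hV, hnt, hcut⟩ := critical D hWF k hk hcol
  let R : ℕ → ℕ → Prop := fun a b => (a, b) ∈ D.arcs ∧ ¬ (a ∈ V ∧ b ∈ V)
  -- no R-path between distinct vertices of V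
  have hR : ∀ u ∈ V, ∀ v ∈ V, ReflTransGen R u v → u = v := by
    intro u hu v hv huv
    by_contra hne
    obtain ⟨Y, hY, huY, hvY, hYk⟩ := exists_cut D hWF u v (hV hu) (hV hv) hne k hlam
    have h1 := hcut (Y ∩ V) Finset.inter_subset_right ⟨u, by simp [hu, huY]⟩
      (by intro h; have : v ∈ Y ∩ V := by rw [h]; exact hv
          simp at this; exact hvY this.1)
    have hsub : cut (ind D.arcs V) (Y ∩ V) ⊆ cut D.arcs Y := by
      intro a ha
      simp only [cut, ind, Finset.mem_filter, Finset.mem_inter] at ha ⊢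
      tauto
    have heq := Finset.eq_of_subset_of_card_le hsub (by omega)
    obtain ⟨p, q, hpq, hp, hq⟩ := reach_cross huv Y huY hvY
    have hmem : (p, q) ∈ cut D.arcs Y := Finset.mem_filter.2 ⟨hpq.1, hp, hq⟩
    rw [← heq] at hmem
    exact hpq.2 (Finset.mem_filter.1 (Finset.mem_filter.1 hmem).1).2
  obtain ⟨h0, hh0, h1, hh1, h01⟩ := hnt
  have hin : ∀ c ∈ D.verts, ∃ f ∈ V, ReflTransGen R f c := by
    intro c hc
    have := strong_reach D hs h0 c (hV hh0) hc
    clear hc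
    induction this with
    | refl => exact ⟨h0, hh0, .refl⟩
    | @tail b c _ hbc ih =>
      obtain ⟨f, hf, hfb⟩ := ih
      by_cases h : b ∈ V ∧ c ∈ V
      · exact ⟨c, h.2, .refl⟩
      · exact ⟨f, hf, hfb.tail ⟨hbc, h⟩⟩
  have hout : ∀ c ∈ D.verts, ∃ f ∈ V, ReflTransGen R c f := by
    intro c hc
    have := strong_reach D hs c h0 hc (hV hh0)
    clear hc
    induction this using ReflTransGen.head_induction_on with
    | refl => exact ⟨h0, hh0, .refl⟩
    | @head b c hbc _ ih =>
      obtain ⟨f, hf, hfb⟩ := ih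
      by_cases h : b ∈ V ∧ c ∈ V
      · exact ⟨b, h.1, .refl⟩
      · exact ⟨f, hf, .head ⟨hbc, h⟩ hfb⟩
  have hall : D.verts ⊆ V := by
    intro c hc
    by_contra hcV
    obtain ⟨h, hh, hhc⟩ := hin c hc
    obtain ⟨h', hh', hhh'⟩ : ∃ h' ∈ V, h' ≠ h := by
      by_cases e : h0 = h
      · exact ⟨h1, hh1, fun e' => h01 (e.trans e'.symm)⟩
      · exact ⟨h0, hh0, e⟩
    have hcon : (D.delVert h).UConnected := by
      by_contra hn
      exact hb.2 h ⟨hV hh, hn⟩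
    have hch : c ≠ h := by rintro rfl; exact hcV hh
    have hreach := hcon.2 c (by simp [delVert, induce, hc, hch]) h'
      (by simp [delVert, induce, hV hh', hhh'])
    have : h' ∉ V ∧ ReflTransGen R h h' := by
      clear hh' hhh'
      induction hreach with
      | refl => exact ⟨hcV, hhc⟩
      | @tail b d _ hbd ih =>
        obtain ⟨hbV, hhb⟩ := ih
        have key : d ∈ D.verts ∧ d ≠ h ∧ (R b d ∨ R d b) := by
          rcases hbd with hbd | hbd
          · simp [delVert, induce] at hbd
            exact ⟨hbd.2.2.2, hbd.2.2.1, Or.inl ⟨hbd.1, by tauto⟩⟩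
          · simp [delVert, induce] at hbd
            exact ⟨hbd.2.1.2, hbd.2.1.1, Or.inr ⟨hbd.1, by tauto⟩⟩
        obtain ⟨hd, hdh, hRd⟩ := key
        have hhd : ReflTransGen R h d := by
          rcases hRd with hRd | hRd
          · exact hhb.tail hRd
          · obtain ⟨f, hf, hfd⟩ := hin d hd
            have hbD : b ∈ D.verts := (hWF _ hRd.1).2.1
            obtain ⟨g, hg, hbg⟩ := hout b hbD
            have e1 := hR h hh g hg (hhb.trans hbg)
            have e2 := hR f hf g hg (hfd.trans (.head hRd hbg))
            rw [e1, ← e2]; exact hfd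
        refine ⟨fun hdV => hdh (hR h hh d hdV hhd).symm, hhd⟩
    exact this.1 hh'
  have hVD : V = D.verts := Finset.Subset.antisymm hV hall
  subst hVD
  intro X hX hne hXV
  refine (hcut X hX hne hXV).trans (Finset.card_le_card ?_)
  intro a ha
  simp only [cut, ind, Finset.mem_filter] at ha ⊢
  tauto

lemma submod (E : Finset (ℕ × ℕ)) (X Y : Finset ℕ) :
    (cut E (X ∩ Y)).card + (cut E (X ∪ Y)).card ≤ (cut E X).card + (cut E Y).card := by
  have h : (((cut E (X ∩ Y)).card + (cut E (X ∪ Y)).card : ℕ) : ℤ) ≤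
      (((cut E X).card + (cut E Y).card : ℕ) : ℤ) := by
    push_cast
    rw [cut_card, cut_card, cut_card, cut_card, ← Finset.sum_add_distrib, ← Finset.sum_add_distrib]
    refine Finset.sum_le_sum fun a _ => ?_
    by_cases h1 : a.1 ∈ X <;> by_cases h2 : a.2 ∈ X <;> by_cases h3 : a.1 ∈ Y <;>
      by_cases h4 : a.2 ∈ Y <;> simp [h1, h2, h3, h4]
  exact_mod_cast h

lemma exs_eq (D : Dgraph) (hWF : D.WF) (X : Finset ℕ) :
    exs D.arcs X = (cut D.arcs X).card - (cut D.arcs (D.verts \ X)).card := by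
  rw [cut_card, cut_card, ← Finset.sum_sub_distrib]
  unfold exs
  refine Finset.sum_congr rfl fun a ha => ?_
  have h := hWF a ha
  by_cases h1 : a.1 ∈ X <;> by_cases h2 : a.2 ∈ X <;> simp [h1, h2, h.1, h.2.1]

lemma exs_verts (D : Dgraph) (hWF : D.WF) : exs D.arcs D.verts = 0 := by
  unfold exs
  refine Finset.sum_eq_zero fun a ha => ?_
  have h := hWF a ha
  simp [h.1, h.2.1]

/-- the dicuts `(X, X̄)` and `(X̄, X)` have the same size -/
lemma eulerian (D : Dgraph) (hWF : D.WF) (k : ℕ) 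
    (hge : ∀ X ⊆ D.verts, X.Nonempty → X ≠ D.verts → k ≤ (cut D.arcs X).card)
    (hle : ∀ u ∈ D.verts, ∀ v ∈ D.verts, u ≠ v →
      ∃ X ⊆ D.verts, u ∈ X ∧ v ∉ X ∧ (cut D.arcs X).card ≤ k) (X : Finset ℕ) (hX : X ⊆ D.verts) :
    (cut D.arcs (D.verts \ X)).card = (cut D.arcs X).card := by
  classical
  have hnn : ∀ v ∈ D.verts, 0 ≤ exv D.arcs v := by
    intro v hv
    let T := D.verts.powerset.filter
      fun X => X.Nonempty ∧ v ∉ X ∧ (cut D.arcs X).card ≤ k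
    have hT : ∀ X, X ∈ T ↔ X ⊆ D.verts ∧ X.Nonempty ∧ v ∉ X ∧ (cut D.arcs X).card ≤ k := by
      intro X; simp [T]
    let M := T.filter fun X => ∀ Y ∈ T, X ⊆ Y → Y = X
    have hM : ∀ X, X ∈ M ↔ X ∈ T ∧ ∀ Y ∈ T, X ⊆ Y → Y = X := by
      intro X; simp only [M, Finset.mem_filter]
    have hdisj : (M : Set (Finset ℕ)).PairwiseDisjoint id := by
      intro X hX Y hY hXY
      rw [Finset.mem_coe, hM] at hX hY
      by_contra hnd
      simp only [id, Function.onFun] at hnd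
      rw [Finset.not_disjoint_iff_nonempty_inter] at hnd
      have hX1 := (hT X).1 hX.1
      have hY1 := (hT Y).1 hY.1
      have hi := hge (X ∩ Y) (Finset.inter_subset_left.trans hX1.1) hnd (by
        intro h
        have : v ∈ X ∩ Y := by rw [h]; exact hv
        exact hX1.2.2.1 (Finset.mem_inter.1 this).1)
      have hs := submod D.arcs X Y
      have hU : X ∪ Y ∈ T := by
        rw [hT]
        refine ⟨Finset.union_subset hX1.1 hY1.1, hX1.2.1.mono Finset.subset_union_left, ?_, ?_⟩
        · simp [hX1.2.2.1, hY1.2.2.1]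
        · have := hX1.2.2.2
          have := hY1.2.2.2
          omega
      have e1 := hX.2 _ hU Finset.subset_union_left
      have e2 := hY.2 _ hU Finset.subset_union_right
      exact hXY (e1.symm.trans e2)
    have hcov : M.biUnion id = D.verts.erase v := by
      ext u
      simp only [Finset.mem_biUnion, id, Finset.mem_erase]
      constructor
      · rintro ⟨X, hXM, huX⟩
        have h1 := (hT X).1 ((hM X).1 hXM).1
        exact ⟨by rintro rfl; exact h1.2.2.1 huX, h1.1 huX⟩
      · rintro ⟨huv, hu⟩
        obtain ⟨X, hX, huX, hvX, hXk⟩ := hle u hu v hv huv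
        have hXT : X ∈ T := (hT X).2 ⟨hX, ⟨u, huX⟩, hvX, hXk⟩
        obtain ⟨Y, hY, hYmax⟩ := Finset.exists_max_image (T.filter fun Y => X ⊆ Y) Finset.card
          ⟨X, by simp [hXT]⟩
        rw [Finset.mem_filter] at hY
        refine ⟨Y, (hM Y).2 ⟨hY.1, ?_⟩, hY.2 huX⟩
        intro Z hZ hYZ
        exact (Finset.eq_of_subset_of_card_le hYZ
          (hYmax Z (Finset.mem_filter.2 ⟨hZ, hY.2.trans hYZ⟩))).symm
    have hsum : ∑ u ∈ D.verts.erase v, exv D.arcs u ≤ 0 := by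
      rw [← hcov, Finset.sum_biUnion hdisj]
      refine Finset.sum_nonpos fun X hX => ?_
      have h1 := (hT X).1 ((hM X).1 hX).1
      have h2 := hge (D.verts \ X) Finset.sdiff_subset ⟨v, by simp [hv, h1.2.2.1]⟩ (by
        intro h
        obtain ⟨x, hx⟩ := h1.2.1
        have : x ∈ D.verts \ X := by rw [h]; exact h1.1 hx
        exact (Finset.mem_sdiff.1 this).2 hx)
      simp only [id]
      rw [sum_exv, exs_eq D hWF]
      have := h1.2.2.2
      omega
    have htot := sum_exv D.arcs D.verts
    rw [exs_verts D hWF, ← Finset.add_sum_erase _ _ hv] at htot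
    omega
  have hz : ∀ v ∈ D.verts, exv D.arcs v = 0 := by
    refine (Finset.sum_eq_zero_iff_of_nonneg hnn).1 ?_
    rw [sum_exv, exs_verts D hWF]
  have h := exs_eq D hWF X
  rw [← sum_exv, Finset.sum_eq_zero fun x hx => hz x (hX hx)] at h
  omega

/-- the contraction map -/
def ctr (D : Dgraph) (A : Finset ℕ) (x : ℕ) : ℕ := if x ∈ A then fresh D else x

lemma fresh_notMem (D : Dgraph) : fresh D ∉ D.verts := by
  intro h
  have := Finset.le_sup (f := id) h
  simp only [fresh, id] at this
  omega

lemma mem_contract (D : Dgraph) (A : Finset ℕ) (e : ℕ × ℕ) :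
    e ∈ (D.contract A).arcs ↔ ∃ x y, (x, y) ∈ D.arcs ∧ ctr D A x ≠ ctr D A y ∧
      e = (ctr D A x, ctr D A y) := by
  simp only [contract, Finset.mem_filter, Finset.mem_image, ctr]
  constructor
  · rintro ⟨⟨⟨x, y⟩, h1, rfl⟩, h2⟩
    exact ⟨x, y, h1, h2, rfl⟩
  · rintro ⟨x, y, h1, h2, rfl⟩
    exact ⟨⟨(x, y), h1, rfl⟩, h2⟩

lemma ctr_mem (D : Dgraph) (A : Finset ℕ) (x : ℕ) (hx : x ∈ D.verts) :
    ctr D A x ∈ (D.contract A).verts := by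
  unfold ctr contract
  split_ifs with h <;> simp [h, hx]

lemma ctr_surj (D : Dgraph) (A : Finset ℕ) (hA : A ⊆ D.verts) (hne : A.Nonempty) (y : ℕ)
    (hy : y ∈ (D.contract A).verts) : ∃ x ∈ D.verts, ctr D A x = y := by
  simp only [contract, Finset.mem_insert, Finset.mem_sdiff] at hy
  rcases hy with rfl | hy
  · obtain ⟨x, hx⟩ := hne
    exact ⟨x, hA hx, by simp [ctr, hx]⟩
  · exact ⟨y, hy.1, by simp [ctr, hy.2]⟩

lemma contract_WF (D : Dgraph) (hWF : D.WF) (A : Finset ℕ) : (D.contract A).WF := by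
  intro e he
  obtain ⟨x, y, h1, h2, rfl⟩ := (mem_contract D A e).1 he
  exact ⟨ctr_mem D A x (hWF _ h1).1, ctr_mem D A y (hWF _ h1).2.1, h2⟩

lemma contract_cut (D : Dgraph) (hWF : D.WF) (A Y : Finset ℕ) :
    (cut (D.contract A).arcs Y).card ≤
      (cut D.arcs (D.verts.filter fun x => ctr D A x ∈ Y)).card := by
  classical
  refine le_trans (Finset.card_le_card ?_) (Finset.card_image_le
    (f := fun e : ℕ × ℕ => (ctr D A e.1, ctr D A e.2)))
  intro e he
  obtain ⟨he1, he2⟩ := Finset.mem_filter.1 he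
  obtain ⟨x, y, h1, h2, rfl⟩ := (mem_contract D A e).1 he1
  refine Finset.mem_image.2 ⟨(x, y), Finset.mem_filter.2 ⟨h1, ?_, ?_⟩, rfl⟩
  · exact Finset.mem_filter.2 ⟨(hWF _ h1).1, he2.1⟩
  · intro h; exact he2.2 (Finset.mem_filter.1 h).2

lemma contract_lam (D : Dgraph) (hWF : D.WF) (k : ℕ)
    (hge : ∀ X ⊆ D.verts, X.Nonempty → X ≠ D.verts → k ≤ (cut D.arcs X).card)
    (hle : ∀ u ∈ D.verts, ∀ v ∈ D.verts, u ≠ v →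
      ∃ X ⊆ D.verts, u ∈ X ∧ v ∉ X ∧ (cut D.arcs X).card ≤ k) (A : Finset ℕ) (hA : A ⊆ D.verts)
    (hAk : (cut D.arcs A).card ≤ k) (hBk : (cut D.arcs (D.verts \ A)).card ≤ k) :
    (D.contract A).lam ≤ k := by
  classical
  have hf := fresh_notMem D
  have hfA : fresh D ∉ A := fun h => hf (hA h)
  refine lam_le _ k ?_
  intro u hu v hv huv
  simp only [contract, Finset.mem_insert, Finset.mem_sdiff] at hu hv
  have aux : ∀ Y Z : Finset ℕ, D.verts.filter (fun x => ctr D A x ∈ Y) = Z →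
      (cut D.arcs Z).card ≤ k → (cut (D.contract A).arcs Y).card ≤ k := by
    rintro Y Z rfl h
    exact (contract_cut D hWF A Y).trans h
  rcases hu with rfl | hu
  · refine ⟨{fresh D}, by simp, by simpa using huv.symm, aux _ A ?_ hAk⟩
    ext x
    simp only [Finset.mem_filter, ctr, Finset.mem_singleton]
    constructor
    · rintro ⟨h1, h2⟩
      by_contra h
      simp only [h, if_false] at h2
      exact hf (h2 ▸ h1)
    · intro h; exact ⟨hA h, by simp [h]⟩
  · rcases hv with rfl | hv
    · refine ⟨D.verts \ A, by simp [hu], by simp [hf], aux _ (D.verts \ A) ?_ hBk⟩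
      ext x
      simp only [Finset.mem_filter, ctr, Finset.mem_sdiff]
      constructor
      · rintro ⟨h1, h2⟩
        by_cases h : x ∈ A
        · simp only [h, if_true] at h2
          exact absurd h2.1 hf
        · exact ⟨h1, h⟩
      · intro h; exact ⟨h.1, by simp [h]⟩
    · obtain ⟨X, hX, huX, hvX, hXk⟩ := hle u hu.1 v hv.1 huv
      have hfX : fresh D ∉ X := fun h => hf (hX h)
      have hvf : v ≠ fresh D := by rintro rfl; exact hf hv.1
      by_cases hXA : (X ∩ A).Nonempty
      · refine ⟨insert (fresh D) X, by simp [huX], by simp [hvX, hvf],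
          aux _ (X ∪ A) ?_ ?_⟩
        · ext x
          simp only [Finset.mem_filter, ctr, Finset.mem_insert, Finset.mem_union]
          constructor
          · rintro ⟨h1, h2⟩
            by_cases h : x ∈ A
            · exact Or.inr h
            · simp only [h, if_false] at h2
              rcases h2 with rfl | h2
              · exact absurd h1 hf
              · exact Or.inl h2
          · intro h
            by_cases h' : x ∈ A
            · simp [h', hA h']
            · have : x ∈ X := by tauto
              simp [h', this, hX this]
        · have h1 := submod D.arcs X A
          have h2 := hge (X ∩ A) (Finset.inter_subset_right.trans hA) hXA (by
            intro h
            have : v ∈ X ∩ A := by rw [h]; exact hv.1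
            exact hvX (Finset.mem_inter.1 this).1)
          omega
      · rw [Finset.not_nonempty_iff_eq_empty] at hXA
        refine ⟨X, huX, hvX, aux _ X ?_ hXk⟩
        ext x
        rw [Finset.mem_filter]
        unfold ctr
        constructor
        · rintro ⟨h1, h2⟩
          by_cases h : x ∈ A
          · simp only [h, if_true] at h2
            exact absurd h2 hfX
          · simpa [h] using h2
        · intro h
          have : x ∉ A := by
            intro h'
            have : x ∈ X ∩ A := Finset.mem_inter.2 ⟨h, h'⟩
            rw [hXA] at this; simp at this
          simp [this, h, hX h]

lemma contract_strong (D : Dgraph) (hWF : D.WF) (hs : D.Strong) (A : Finset ℕ)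
    (hA : A ⊆ D.verts) (hne : A.Nonempty) : (D.contract A).Strong := by
  intro u hu v hv huv
  obtain ⟨x, hx, rfl⟩ := ctr_surj D A hA hne u hu
  obtain ⟨y, hy, rfl⟩ := ctr_surj D A hA hne v hv
  have h := strong_reach D hs x y hx hy
  have h2 : ReflTransGen (fun a b => (a, b) ∈ (D.contract A).arcs) (ctr D A x) (ctr D A y) := by
    clear huv hv hy
    induction h with
    | refl => exact .refl
    | @tail b c _ hbc ih =>
      by_cases e : ctr D A b = ctr D A c
      · rw [← e]; exact ih
      · exact ih.tail ((mem_contract D A _).2 ⟨b, c, hbc, e, rfl⟩)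
  obtain ⟨p, hn, hh, hl, hc⟩ := exists_path h2
  exact ⟨p, isDipath_of _ (contract_WF D hWF A) _ _ hu p hn hh hl hc⟩

lemma split_count_aux (V A S : Finset ℕ) (a : ℕ × ℕ) (e1 : a.1 ∈ V) (e1b : a.2 ∈ V)
    (e2 : a.1 ∉ A → a.2 ∉ A → (a.1 ∈ S ↔ a.2 ∈ S)) (e3 : a.1 ∈ S → a.1 ∉ A)
    (e4 : a.2 ∈ S → a.2 ∉ A) :
    ((if a.1 ∈ S ∧ a.2 ∉ S then 1 else 0) + (if a.1 ∈ (V \ A) \ S ∧ a.2 ∉ (V \ A) \ S then 1 else 0) : ℤ)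
      ≤ (if a.1 ∈ V \ A ∧ a.2 ∉ V \ A then 1 else 0) := by
  simp only [Finset.mem_sdiff]
  by_cases c1 : a.1 ∈ S <;> by_cases c2 : a.2 ∈ S <;> by_cases c3 : a.1 ∈ A <;>
    by_cases c4 : a.2 ∈ A <;> simp_all

lemma contract_bic (D : Dgraph) (hWF : D.WF) (hs : D.Strong) (hb : D.Biconnected)
    (k : ℕ) (hk : 1 ≤ k)
    (hge : ∀ X ⊆ D.verts, X.Nonempty → X ≠ D.verts → k ≤ (cut D.arcs X).card)
    (A : Finset ℕ) (hA : A ⊆ D.verts) (hne : A.Nonempty) (hAV : A ≠ D.verts)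
    (hBk : (cut D.arcs (D.verts \ A)).card ≤ k) : (D.contract A).Biconnected := by
  classical
  have hf := fresh_notMem D
  have hs' := contract_strong D hWF hs A hA hne
  refine ⟨⟨⟨fresh D, by simp [contract]⟩, ?_⟩, ?_⟩
  · intro u hu v hv
    exact ReflTransGen.mono (fun _ _ h => Or.inl h) _ _ (strong_reach _ hs' u v hu hv)
  · rintro w ⟨hw, hcon⟩
    apply hcon
    have hdv : ∀ x, x ∈ ((D.contract A).delVert w).verts ↔ x ∈ (D.contract A).verts ∧ x ≠ w := by
      intro x; simp [delVert, induce]; tauto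
    have hda : ∀ x y, (x, y) ∈ ((D.contract A).delVert w).arcs ↔
        (x, y) ∈ (D.contract A).arcs ∧ x ≠ w ∧ y ≠ w := by
      intro x y
      simp only [delVert, induce, Finset.mem_filter, Finset.mem_erase]
      constructor
      · tauto
      · rintro ⟨h1, h2, h3⟩
        have := contract_WF D hWF A _ h1
        exact ⟨h1, ⟨h2, this.1⟩, ⟨h3, this.2.1⟩⟩
    obtain ⟨b0, hb0, hb0A⟩ : ∃ b ∈ D.verts, b ∉ A := by
      by_contra h
      push Not at h
      exact hAV (Finset.Subset.antisymm hA h)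
    simp only [contract, Finset.mem_insert, Finset.mem_sdiff] at hw
    rcases hw with rfl | hw
    · -- the new vertex
      have hv' : ∀ x, x ∈ ((D.contract A).delVert (fresh D)).verts ↔ x ∈ D.verts ∧ x ∉ A := by
        intro x
        rw [hdv]
        simp only [contract, Finset.mem_insert, Finset.mem_sdiff]
        constructor
        · tauto
        · intro h; exact ⟨Or.inr h, by rintro rfl; exact hf h.1⟩
      have ha' : ∀ x y, (x, y) ∈ D.arcs → x ∉ A → y ∉ A →
          (x, y) ∈ ((D.contract A).delVert (fresh D)).arcs := by
        intro x y h hx hy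
        have h1 := hWF _ h
        rw [hda]
        refine ⟨(mem_contract D A _).2 ⟨x, y, h, ?_, ?_⟩, ?_, ?_⟩
        · simp only [ctr, hx, hy, if_false]; exact h1.2.2
        · simp [ctr, hx, hy]
        · rintro rfl; exact hf h1.1
        · rintro rfl; exact hf h1.2.1
      refine ⟨⟨b0, (hv' b0).2 ⟨hb0, hb0A⟩⟩, ?_⟩
      intro u hu v hv
      rw [hv'] at hu hv
      by_contra hr
      let S : Finset ℕ := (D.verts \ A).filter
        fun x => ((D.contract A).delVert (fresh D)).UReach u x
      have hSmem : ∀ x, x ∈ S ↔ (x ∈ D.verts ∧ x ∉ A) ∧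
          ((D.contract A).delVert (fresh D)).UReach u x := by
        intro x; simp [S]
      have hSB : S ⊆ D.verts \ A := Finset.filter_subset _ _
      have huS : u ∈ S := (hSmem u).2 ⟨hu, .refl⟩
      have hvS : v ∉ S := fun h => hr ((hSmem v).1 h).2
      have hno : ∀ x y, (x, y) ∈ D.arcs → x ∉ A → y ∉ A → (x ∈ S ↔ y ∈ S) := by
        intro x y h hx hy
        rw [hSmem, hSmem]
        have h1 := hWF _ h
        constructor
        · intro h2
          exact ⟨⟨h1.2.1, hy⟩, h2.2.tail (Or.inl (ha' x y h hx hy))⟩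
        · intro h2
          exact ⟨⟨h1.1, hx⟩, h2.2.tail (Or.inr (ha' x y h hx hy))⟩
      have h1 := hge S (hSB.trans Finset.sdiff_subset) ⟨u, huS⟩
        (by intro h; rw [h] at hvS; exact hvS hv.1)
      have h2 := hge ((D.verts \ A) \ S) (Finset.sdiff_subset.trans Finset.sdiff_subset)
        ⟨v, by simp [hv, hvS]⟩ (by
          intro h
          have : u ∈ (D.verts \ A) \ S := by rw [h]; exact hu.1
          exact (Finset.mem_sdiff.1 this).2 huS)
      have h3 : ((cut D.arcs S).card : ℤ) + (cut D.arcs ((D.verts \ A) \ S)).card ≤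
          (cut D.arcs (D.verts \ A)).card := by
        rw [cut_card, cut_card, cut_card, ← Finset.sum_add_distrib]
        refine Finset.sum_le_sum fun a ha => ?_
        have e1 := hWF a ha
        have e2 := hno a.1 a.2 ha
        have e3 : a.1 ∈ S → a.1 ∉ A := fun h => ((hSmem _).1 h).1.2
        have e4 : a.2 ∈ S → a.2 ∉ A := fun h => ((hSmem _).1 h).1.2
        exact split_count_aux D.verts A S a e1.1 e1.2.1 e2 e3 e4
      omega
    · -- an old vertex
      have hconn : (D.delVert w).UConnected := by
        by_contra h
        exact hb.2 w ⟨hw.1, h⟩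
      have hlift : ∀ y ∈ ((D.contract A).delVert w).verts,
          ∃ x ∈ (D.delVert w).verts, ctr D A x = y := by
        intro y hy
        rw [hdv] at hy
        obtain ⟨x, hx, rfl⟩ := ctr_surj D A hA hne y hy.1
        refine ⟨x, ?_, rfl⟩
        simp only [delVert, induce, Finset.mem_inter, Finset.mem_erase]
        refine ⟨hx, ?_, hx⟩
        rintro rfl
        apply hy.2; simp [ctr, hw.2]
      refine ⟨⟨fresh D, (hdv _).2 ⟨by simp [contract], by rintro rfl; exact hf hw.1⟩⟩, ?_⟩
      intro u hu v hv
      obtain ⟨x, hx, rfl⟩ := hlift u hu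
      obtain ⟨y, hy, rfl⟩ := hlift v hv
      have h := hconn.2 x hx y hy
      clear hv hy
      have hcw : ∀ z, z ≠ w → ctr D A z ≠ w := by
        intro z hz
        unfold ctr
        split_ifs
        · rintro rfl; exact hf hw.1
        · exact hz
      have step : ∀ b c, (b, c) ∈ (D.delVert w).arcs → ctr D A b ≠ ctr D A c →
          (ctr D A b, ctr D A c) ∈ ((D.contract A).delVert w).arcs := by
        intro b c hbc e
        simp only [delVert, induce, Finset.mem_filter, Finset.mem_erase] at hbc
        rw [hda]
        exact ⟨(mem_contract D A _).2 ⟨b, c, hbc.1, e, rfl⟩, hcw _ hbc.2.1.1, hcw _ hbc.2.2.1⟩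
      induction h with
      | refl => exact .refl
      | @tail b c _ hbc ih =>
        by_cases e : ctr D A b = ctr D A c
        · rw [← e]; exact ih
        · refine ReflTransGen.tail ih ?_
          rcases hbc with hbc | hbc
          · exact Or.inl (step _ _ hbc e)
          · exact Or.inr (step _ _ hbc (Ne.symm e))

lemma exists_perm {k : ℕ} (a b c d : Fin k) (hab : a ≠ b) (hcd : c ≠ d) :
    ∃ σ : Equiv.Perm (Fin k), σ a = c ∧ σ b = d := by
  have h1 : Equiv.swap a c b ≠ c := by
    intro h
    have : Equiv.swap a c b = Equiv.swap a c a := by rw [h, Equiv.swap_apply_left]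
    exact hab ((Equiv.swap a c).injective this).symm
  refine ⟨(Equiv.swap a c).trans (Equiv.swap (Equiv.swap a c b) d), ?_, ?_⟩
  · rw [Equiv.trans_apply, Equiv.swap_apply_left, Equiv.swap_apply_of_ne_of_ne h1.symm hcd]
  · rw [Equiv.trans_apply, Equiv.swap_apply_left]

lemma rowcol {k : ℕ} (E : Finset (ℕ × ℕ)) (hE : E.card ≤ k) (t h : ℕ × ℕ → Fin k)
    (hall : ∀ σ : Equiv.Perm (Fin k), ∃ e ∈ E, σ (t e) = h e) :
    (∀ e ∈ E, ∀ f ∈ E, t e = t f) ∨ (∀ e ∈ E, ∀ f ∈ E, h e = h f) := by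
  classical
  have hpair : ∀ e ∈ E, ∀ f ∈ E, t e = t f ∨ h e = h f := by
    intro e he f hf
    by_contra hcon
    push Not at hcon
    have : NeZero k := ⟨by rintro rfl; exact (t e).elim0⟩
    obtain ⟨σ, h1, h2⟩ := exists_perm (t e) (t f) (h e) (h f) hcon.1 hcon.2
    have hsurj : (Finset.univ : Finset (Fin k)) ⊆ E.image fun e => h e - σ (t e) := by
      intro j _
      obtain ⟨g, hg, hgj⟩ := hall (σ.trans (Equiv.addLeft j))
      refine Finset.mem_image.2 ⟨g, hg, ?_⟩
      rw [← hgj]; simp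
    have hc1 := Finset.card_le_card hsurj
    rw [Finset.card_univ, Fintype.card_fin] at hc1
    have hinj : Set.InjOn (fun e => h e - σ (t e)) E := by
      refine Finset.injOn_of_card_image_eq ?_
      exact le_antisymm Finset.card_image_le (hE.trans hc1)
    have : e = f := hinj he hf (by simp [h1, h2])
    exact hcon.1 (by rw [this])
  by_cases ht : ∀ e ∈ E, ∀ f ∈ E, t e = t f
  · exact Or.inl ht
  · right
    push Not at ht
    obtain ⟨e, he, f, hf, hef⟩ := ht
    have hefh := (hpair e he f hf).resolve_left hef
    have key : ∀ g ∈ E, h g = h e := by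
      intro g hg
      by_cases hge : t g = t e
      · have := (hpair g hg f hf).resolve_left (by rw [hge]; exact hef)
        rw [this, hefh]
      · exact (hpair g hg e he).resolve_left hge
    intro a ha b hb
    rw [key a ha, key b hb]

lemma ctr_of_mem {D : Dgraph} {A : Finset ℕ} {x : ℕ} (h : x ∈ A) : ctr D A x = fresh D := by
  simp [ctr, h]

lemma ctr_of_notMem {D : Dgraph} {A : Finset ℕ} {x : ℕ} (h : x ∉ A) : ctr D A x = x := by
  simp [ctr, h]

/-- a crossing monochromatic closed walk in the colour of the contracted vertex is impossible -/
lemma no_cross {k : ℕ} (D : Dgraph) (hWF : D.WF) (A : Finset ℕ) (hA : A ⊆ D.verts)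
    (φ ψ : ℕ → Fin k) (hφ : Good (D.contract A).arcs φ) (hag : ∀ x ∈ D.verts, x ∉ A → ψ x = φ x)
    (p q : ℕ) (hpq : (p, q) ∈ D.arcs) (hp : p ∈ A) (hq : q ∉ A) (hc : ψ p = ψ q)
    (hr : ReflTransGen (mono D.arcs ψ) q p) (hcol : ψ q = φ (fresh D)) : False := by
  have hf := fresh_notMem D
  have hcc : ∀ x ∈ D.verts, ψ x = ψ q → φ (ctr D A x) = φ (fresh D) := by
    intro x hx hxq
    by_cases h : x ∈ A
    · rw [ctr_of_mem h]
    · rw [ctr_of_notMem h, ← hag x hx h, hxq, hcol]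
  have hm : ∀ x, ReflTransGen (mono D.arcs ψ) q x →
      ReflTransGen (mono (D.contract A).arcs φ) (ctr D A q) (ctr D A x) := by
    intro x hx
    induction hx with
    | refl => exact .refl
    | @tail b c hb hbc ih =>
      by_cases e : ctr D A b = ctr D A c
      · rw [← e]; exact ih
      · refine ih.tail ⟨(mem_contract D A _).2 ⟨b, c, hbc.1, e, rfl⟩, ?_⟩
        have h1 := mono_reach_eq hb
        rw [hcc b (hWF _ hbc.1).1 h1.symm, hcc c (hWF _ hbc.1).2.1 (hbc.2.symm.trans h1.symm)]
  have h1 := hm p hr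
  rw [ctr_of_mem hp] at h1
  refine hφ (fresh D) (TransGen.head' ⟨(mem_contract D A _).2 ⟨p, q, hpq, ?_, ?_⟩, ?_⟩ h1)
  · rw [ctr_of_mem hp, ctr_of_notMem hq]; rintro rfl; exact hf (hWF _ hpq).2.1
  · rw [ctr_of_mem hp]
  · exact (hcc q (hWF _ hpq).2.1 rfl).symm

lemma comb {k : ℕ} (D : Dgraph) (hWF : D.WF) (A : Finset ℕ) (hA : A ⊆ D.verts)
    (φ₁ φ₂ : ℕ → Fin k) (h₁ : Good (D.contract A).arcs φ₁)
    (h₂ : Good (D.contract (D.verts \ A)).arcs φ₂) (hcol : ¬ Col D.arcs k)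
    (σ : Equiv.Perm (Fin k)) :
    ∃ e ∈ cut D.arcs A, ∃ f ∈ cut D.arcs (D.verts \ A), σ (φ₂ e.1) = φ₁ e.2 ∧
      σ (φ₂ f.2) = φ₁ f.1 ∧ φ₁ e.2 = φ₁ f.1 ∧ φ₁ e.2 ≠ φ₁ (fresh D) ∧
      φ₁ e.2 ≠ σ (φ₂ (fresh D)) := by
  classical
  let B := D.verts \ A
  let ψ : ℕ → Fin k := fun x => if x ∈ A then σ (φ₂ x) else φ₁ x
  have hψA : ∀ x ∈ A, ψ x = σ (φ₂ x) := fun x hx => by simp [ψ, hx]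
  have hψB : ∀ x, x ∉ A → ψ x = φ₁ x := fun x hx => by simp [ψ, hx]
  have h₂' : Good (D.contract B).arcs (fun x => σ (φ₂ x)) := by
    intro x hx
    refine h₂ x (tmono hx ?_)
    rintro a b ⟨h1, h2⟩
    exact ⟨h1, σ.injective h2⟩
  have hAB : ∀ x ∈ A, x ∉ B := fun x hx h => (Finset.mem_sdiff.1 h).2 hx
  have hloop : ∃ x, TransGen (mono D.arcs ψ) x x := by
    by_contra h
    push Not at h
    exact hcol ⟨ψ, h⟩
  obtain ⟨x, hx⟩ := hloop
  have noA : ¬ TransGen (fun p q => mono D.arcs ψ p q ∧ p ∈ A ∧ q ∈ A) x x := by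
    intro h
    refine h₂' x (tmono h ?_)
    rintro a b ⟨⟨h1, h2⟩, h3, h4⟩
    refine ⟨(mem_contract D B _).2 ⟨a, b, h1, ?_, ?_⟩, ?_⟩
    · rw [ctr_of_notMem (hAB a h3), ctr_of_notMem (hAB b h4)]; exact (hWF _ h1).2.2
    · rw [ctr_of_notMem (hAB a h3), ctr_of_notMem (hAB b h4)]
    · rwa [hψA a h3, hψA b h4] at h2
  have noB : ¬ TransGen (fun p q => mono D.arcs ψ p q ∧ ¬ p ∈ A ∧ ¬ q ∈ A) x x := by
    intro h
    refine h₁ x (tmono h ?_)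
    rintro a b ⟨⟨h1, h2⟩, h3, h4⟩
    refine ⟨(mem_contract D A _).2 ⟨a, b, h1, ?_, ?_⟩, ?_⟩
    · rw [ctr_of_notMem h3, ctr_of_notMem h4]; exact (hWF _ h1).2.2
    · rw [ctr_of_notMem h3, ctr_of_notMem h4]
    · rwa [hψB a h3, hψB b h4] at h2
  have c1 : ∃ p q, mono D.arcs ψ p q ∧ ReflTransGen (mono D.arcs ψ) x p ∧
      ReflTransGen (mono D.arcs ψ) q x ∧ p ∈ A ∧ q ∉ A := by
    rcases loop_cross (· ∈ A) hx with h | h | h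
    · exact h
    · exact absurd h noA
    · exact absurd h noB
  have c2 : ∃ p q, mono D.arcs ψ p q ∧ ReflTransGen (mono D.arcs ψ) x p ∧
      ReflTransGen (mono D.arcs ψ) q x ∧ p ∉ A ∧ ¬ q ∉ A := by
    rcases loop_cross (· ∉ A) hx with h | h | h
    · exact h
    · exact absurd h noB
    · exact absurd (tmono h fun a b h => ⟨h.1, not_not.1 h.2.1, not_not.1 h.2.2⟩) noA
  obtain ⟨p, q, hpq, hxp, hqx, hp, hq⟩ := c1
  obtain ⟨r, s, hrs, hxr, hsx, hr, hs⟩ := c2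
  rw [not_not] at hs
  have hrD := (hWF _ hrs.1).1
  have hqD := (hWF _ hpq.1).2.1
  have e1 := mono_reach_eq hxp
  have e2 := mono_reach_eq hxr
  have e3 := mono_reach_eq hqx
  have e4 := mono_reach_eq hsx
  have eqr : ψ q = ψ r := e3.trans e2
  have epq := hpq.2
  have ers := hrs.2
  refine ⟨(p, q), Finset.mem_filter.2 ⟨hpq.1, hp, hq⟩, (r, s),
    Finset.mem_filter.2 ⟨hrs.1, by simp [hr, hrD], by simp [hs]⟩, ?_, ?_, ?_, ?_, ?_⟩
  · rwa [hψA p hp, hψB q hq] at epq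
  · rw [hψA s hs, hψB r hr] at ers; exact ers.symm
  · rwa [hψB q hq, hψB r hr] at eqr
  · intro hcon
    exact no_cross D hWF A hA φ₁ ψ h₁ (fun x _ hx => hψB x hx) p q hpq.1 hp hq epq
      (hqx.trans hxp) ((hψB q hq).trans hcon)
  · intro hcon
    refine no_cross D hWF B Finset.sdiff_subset (fun x => σ (φ₂ x)) ψ h₂' ?_ r s hrs.1
      (Finset.mem_sdiff.2 ⟨hrD, hr⟩) (hAB s hs) ers (hsx.trans hxr) ?_
    · intro y hy hyB
      refine hψA y ?_
      by_contra h
      exact hyB (Finset.mem_sdiff.2 ⟨hy, h⟩)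
    · rw [← ers, ← eqr, hψB q hq, hcon]

lemma chrom {k : ℕ} (D : Dgraph) (hWF : D.WF) (A : Finset ℕ) (hA : A ⊆ D.verts)
    (hAk : (cut D.arcs A).card ≤ k) (hBk : (cut D.arcs (D.verts \ A)).card ≤ k)
    (h₁ : Col (D.contract A).arcs k) (h₂ : Col (D.contract (D.verts \ A)).arcs k) :
    Col D.arcs k := by
  by_contra hcol
  obtain ⟨φ₁, h₁⟩ := h₁
  obtain ⟨φ₂, h₂⟩ := h₂
  have H := comb D hWF A hA φ₁ φ₂ h₁ h₂ hcol
  have pick : ∀ γ ε : Fin k, ∃ σ : Equiv.Perm (Fin k), σ γ ≠ ε ∨ ∀ a b : Fin k, a = b := by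
    intro γ ε
    by_cases h : ∀ a b : Fin k, a = b
    · exact ⟨1, Or.inr h⟩
    · have : Nontrivial (Fin k) := by
        push Not at h
        exact ⟨h⟩
      obtain ⟨d, hd⟩ := exists_ne ε
      exact ⟨Equiv.swap γ d, Or.inl (by rwa [Equiv.swap_apply_left])⟩
  obtain ⟨e₀, he₀, f₀, hf₀, -⟩ := H 1
  have R1 := rowcol (cut D.arcs A) hAk (fun e => φ₂ e.1) (fun e => φ₁ e.2) (fun σ => by
    obtain ⟨e, he, f, hf, h, -⟩ := H σ
    exact ⟨e, he, h⟩)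
  have R2 := rowcol (cut D.arcs (D.verts \ A)) hBk (fun e => φ₂ e.2) (fun e => φ₁ e.1) (fun σ => by
    obtain ⟨e, he, f, hf, -, h, -⟩ := H σ
    exact ⟨f, hf, h⟩)
  rcases R1 with R1 | R1 <;> rcases R2 with R2 | R2
  · obtain ⟨e, he, f, hf, a1, a2, a3, a4, a5⟩ :=
      H (Equiv.swap (φ₂ e₀.1) (φ₁ (fresh D)))
    apply a4
    rw [← a1, R1 e he e₀ he₀, Equiv.swap_apply_left]
  · obtain ⟨σ, hσ⟩ := pick (φ₂ e₀.1) (φ₁ f₀.1)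
    obtain ⟨e, he, f, hf, a1, a2, a3, a4, a5⟩ := H σ
    rcases hσ with hσ | hσ
    · apply hσ
      rw [R1 e₀ he₀ e he, R2 f₀ hf₀ f hf, a1, a3]
    · exact a4 (hσ _ _)
  · obtain ⟨σ, hσ⟩ := pick (φ₂ f₀.2) (φ₁ e₀.2)
    obtain ⟨e, he, f, hf, a1, a2, a3, a4, a5⟩ := H σ
    rcases hσ with hσ | hσ
    · apply hσ
      rw [R1 e₀ he₀ e he, R2 f₀ hf₀ f hf, a2, a3]
    · exact a4 (hσ _ _)
  · obtain ⟨e, he, f, hf, a1, a2, a3, a4, a5⟩ :=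
      H (Equiv.swap (φ₂ (fresh D)) (φ₁ e₀.2))
    apply a5
    rw [R1 e he e₀ he₀, Equiv.swap_apply_left]

lemma contract_extremal (D : Dgraph) (hWF : D.WF) (hs : D.Strong) (hb : D.Biconnected)
    (k : ℕ) (hk : 1 ≤ k)
    (hge : ∀ X ⊆ D.verts, X.Nonempty → X ≠ D.verts → k ≤ (cut D.arcs X).card)
    (hle : ∀ u ∈ D.verts, ∀ v ∈ D.verts, u ≠ v →
      ∃ X ⊆ D.verts, u ∈ X ∧ v ∉ X ∧ (cut D.arcs X).card ≤ k)
    (A : Finset ℕ) (hA : A ⊆ D.verts) (hne : A.Nonempty) (hAV : A ≠ D.verts)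
    (hAk : (cut D.arcs A).card ≤ k) (hBk : (cut D.arcs (D.verts \ A)).card ≤ k)
    (hcol : ¬ Col (D.contract A).arcs k) : Extremal k (D.contract A) := by
  have hW := contract_WF D hWF A
  have hlam := contract_lam D hWF k hge hle A hA hAk hBk
  refine ⟨contract_bic D hWF hs hb k hk hge A hA hne hAV hBk, contract_strong D hWF hs A hA hne,
    dichi_eq _ hW k ?_ hcol, le_antisymm hlam (le_lam_of_not_col _ hW k hk hcol)⟩
  by_contra h
  have := le_lam_of_not_col _ hW (k + 1) (by omega) h
  omega

end S6

/-- Lemma 4.4: if D is k-extremal and (A, Ā) is a minimum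
dicut, then D/A or D/Ā is k-extremal. -/
theorem statement_6 (k : ℕ) (hk : 1 ≤ k) (D : Dgraph) (hWF : D.WF)
    (hext : Extremal k D) (A : Finset ℕ) (hmin : D.IsMinDicut A) :
    Extremal k (D.contract A) ∨ Extremal k (D.contract (D.verts \ A)) := by
  classical
  obtain ⟨hb, hs, hchi, hlam⟩ := hext
  obtain ⟨⟨hA, hne, hAV⟩, hmn⟩ := hmin
  have hcol := S6.not_col_of_dichi D hWF k (by omega)
  have hge := S6.all_cuts D hWF k hk hb hs hcol hlam.le
  have hle : ∀ u ∈ D.verts, ∀ v ∈ D.verts, u ≠ v →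
      ∃ X ⊆ D.verts, u ∈ X ∧ v ∉ X ∧ (S6.cut D.arcs X).card ≤ k :=
    fun u hu v hv huv => S6.exists_cut D hWF u v hu hv huv k hlam.le
  obtain ⟨a, ha⟩ := hne
  obtain ⟨b, hbD, hbA⟩ : ∃ b ∈ D.verts, b ∉ A := by
    by_contra h
    push Not at h
    exact hAV (Finset.Subset.antisymm hA h)
  have hAk : (S6.cut D.arcs A).card ≤ k := by
    obtain ⟨X, hX, haX, hbX, hXk⟩ := hle a (hA ha) b hbD (by rintro rfl; exact hbA ha)
    exact (hmn X ⟨hX, ⟨a, haX⟩, by rintro rfl; exact hbX hbD⟩).trans hXk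
  have hBk : (S6.cut D.arcs (D.verts \ A)).card ≤ k := by
    rw [S6.eulerian D hWF k hge hle A hA]; exact hAk
  by_cases h1 : S6.Col (D.contract A).arcs k
  · right
    refine S6.contract_extremal D hWF hs hb k hk hge hle _ Finset.sdiff_subset
      ⟨b, by simp [hbD, hbA]⟩ ?_ hBk ?_ ?_
    · intro h
      have : a ∈ D.verts \ A := by rw [h]; exact hA ha
      exact (Finset.mem_sdiff.1 this).2 ha
    · rw [Finset.sdiff_sdiff_eq_self hA]; exact hAk
    · intro h2
      exact hcol (S6.chrom D hWF A hA hAk hBk h1 h2)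
  · left
    exact S6.contract_extremal D hWF hs hb k hk hge hle A hA ⟨a, ha⟩ hAV hAk hBk h1
end
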